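/- arXiv:1812.01047 — 4 statements merged into one kernel-verified Lean document; each statement's English description precedes it below -/
import Mathlib

section
/- For all integers n and k with 1 ≤ k ≤ n−1, the maximum number of edges in a graph on n vertices containing no linear forest with k edges equals max{ C(k,2), C(n,2) − C(n−⌊(k−1)/2⌋, 2) + c }, where c = 0 if k is odd and c = 1 if k is even. -/
/-- A linear forest is a graph all of whose connected components are paths or
isolated vertices; equivalently, an acyclic graph of maximum degree at most 2. -/
def IsLinearForest {V : Type*} (F : SimpleGraph V) : Prop :=
  F.IsAcyclic ∧ ∀ v : V, (F.neighborSet v).ncard ≤ 2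

/-- The edges of `G` joining vertices with consecutive labels. -/
def consecutiveSubgraph {V : Type*} (G : SimpleGraph V) (y : V → ℤ) : SimpleGraph V where
  Adj a b := G.Adj a b ∧ (y b = y a + 1 ∨ y a = y b + 1)
  symm := ⟨fun _ _ h => ⟨h.1.symm, h.2.symm⟩⟩
  loopless := ⟨fun _ h => h.1.ne rfl⟩

section

variable {V : Type*} {G F : SimpleGraph V} {y : V → ℤ}

lemma consecutiveSubgraph_adj {a b : V} : (consecutiveSubgraph G y).Adj a b ↔
    G.Adj a b ∧ (y b = y a + 1 ∨ y a = y b + 1) := Iff.rfl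

lemma consecutiveSubgraph_le : consecutiveSubgraph G y ≤ G := fun _ _ h => h.1

lemma isAcyclic_consecutiveSubgraph (hy : y.Injective) :
    (consecutiveSubgraph G y).IsAcyclic := by
  have key : ∀ a b, y b = y a + 1 →
      ¬ ((consecutiveSubgraph G y).deleteEdges {s(a, b)}).Reachable a b := by
    intro a b hab ⟨w⟩
    have : ∀ {c d} (_ : ((consecutiveSubgraph G y).deleteEdges {s(a, b)}).Walk c d),
        y c ≤ y a → y d ≤ y a := by
      intro c d w
      induction w with
      | nil => exact id
      | @cons u v w h p ih =>
        intro hu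
        apply ih
        rw [SimpleGraph.deleteEdges_adj, consecutiveSubgraph_adj] at h
        obtain ⟨⟨-, h1⟩, h2⟩ := h
        by_contra hlt
        have hua : u = a := hy (by omega)
        have hvb : v = b := hy (by omega)
        simp [hua, hvb] at h2
    have := this w le_rfl
    omega
  rw [SimpleGraph.isAcyclic_iff_forall_adj_isBridge]
  intro a b h
  rw [SimpleGraph.isBridge_iff]
  rcases h.2 with h | h
  · exact key a b h
  · intro hr
    rw [Sym2.eq_swap] at hr
    exact key b a h hr.symm

lemma ncard_neighborSet_consecutiveSubgraph_le (hy : y.Injective) (v : V) :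
    ((consecutiveSubgraph G y).neighborSet v).ncard ≤ 2 := by
  refine (Set.ncard_le_ncard_of_injOn (t := ({y v + 1, y v - 1} : Set ℤ)) y ?_ hy.injOn).trans
    ((Set.ncard_insert_le _ _).trans_eq (by rw [Set.ncard_singleton]))
  intro w hw
  rcases hw.2 with h | h
  · exact Or.inl h
  · right
    simp only [Set.mem_singleton_iff]
    omega

lemma IsLinearForest.anti [Finite V] {F' : SimpleGraph V} (hle : F ≤ F') (h : IsLinearForest F') :
    IsLinearForest F :=
  ⟨h.1.anti hle, fun v => (Set.ncard_le_ncard (fun _ hw => hle hw) (Set.toFinite _)).trans (h.2 v)⟩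

lemma exists_isLinearForest_of_le_ncard [Finite V] {k : ℕ} (hy : y.Injective)
    (hk : k ≤ (consecutiveSubgraph G y).edgeSet.ncard) :
    ∃ F ≤ G, IsLinearForest F ∧ F.edgeSet.ncard = k := by
  obtain ⟨s, hs, hsk⟩ := Set.exists_subset_card_eq hk
  have hle : SimpleGraph.fromEdgeSet s ≤ consecutiveSubgraph G y := by
    rw [← SimpleGraph.fromEdgeSet_edgeSet (consecutiveSubgraph G y)]
    exact SimpleGraph.fromEdgeSet_mono hs
  refine ⟨SimpleGraph.fromEdgeSet s, hle.trans consecutiveSubgraph_le,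
    IsLinearForest.anti hle ⟨isAcyclic_consecutiveSubgraph hy,
      ncard_neighborSet_consecutiveSubgraph_le hy⟩, ?_⟩
  rw [SimpleGraph.edgeSet_fromEdgeSet, sdiff_eq_left.2, hsk]
  rw [Set.disjoint_left]
  exact fun e he => (consecutiveSubgraph G y).not_isDiag_of_mem_edgeSet (hs he)

lemma exists_segment_reversal {a i : ℤ} (hai : a ≠ i) : ∃ r : ℤ → ℤ, r.Injective ∧
    (∀ j, j ≠ a → j ≠ i → r (j + 1) = r j + 1 ∨ r j = r (j + 1) + 1) ∧
    (r i = r a + 1 ∨ r a = r i + 1) ∧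
    (r (i + 1) = r (a + 1) + 1 ∨ r (a + 1) = r (i + 1) + 1) := by
  rcases lt_or_gt_of_ne hai with h | h
  · refine ⟨fun j => if a + 1 ≤ j ∧ j ≤ i then a + 1 + i - j else j, ?_, ?_, ?_, ?_⟩
    · intro p q hpq
      dsimp only at hpq
      split_ifs at hpq <;> omega
    · intro j _ _
      dsimp only
      split_ifs <;> omega
    all_goals dsimp only; split_ifs <;> omega
  · refine ⟨fun j => if i + 1 ≤ j ∧ j ≤ a then i + 1 + a - j else j, ?_, ?_, ?_, ?_⟩
    · intro p q hpq
      dsimp only at hpq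
      split_ifs at hpq <;> omega
    · intro j _ _
      dsimp only
      split_ifs <;> omega
    all_goals dsimp only; split_ifs <;> omega

/-- Reversing a segment of a labelling next to the gap between `u` and `v`. -/
lemma exists_segment_reversed_labelling {u v : V} (hy : y.Injective) (huv : y v = y u + 1)
    (hadj : ¬ G.Adj u v) {i : ℤ} (hi : i ≠ y u) :
    ∃ y' : V → ℤ, y'.Injective ∧
      (∀ p q, (consecutiveSubgraph G y).Adj p q → ¬ (y p = i ∧ y q = i + 1) →
        ¬ (y q = i ∧ y p = i + 1) → (consecutiveSubgraph G y').Adj p q) ∧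
      (∀ p, y p = i → G.Adj u p → (consecutiveSubgraph G y').Adj u p) ∧
      (∀ q, y q = i + 1 → G.Adj v q → (consecutiveSubgraph G y').Adj v q) := by
  obtain ⟨r, hr, h1, h2, h3⟩ := exists_segment_reversal hi.symm
  refine ⟨r ∘ y, hr.comp hy, ?_, ?_, ?_⟩
  · rintro p q ⟨hG, hpq⟩ hn1 hn2
    refine ⟨hG, ?_⟩
    have key : ∀ p q, G.Adj p q → y q = y p + 1 → ¬ (y p = i ∧ y q = i + 1) →
        r (y q) = r (y p) + 1 ∨ r (y p) = r (y q) + 1 := by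
      intro p q hG hpq hn
      rw [hpq]
      refine h1 _ (fun h => ?_) (fun h => hn ⟨h, by omega⟩)
      have hp : p = u := hy h
      have hq : q = v := hy (by omega)
      exact hadj (hp ▸ hq ▸ hG)
    rcases hpq with h | h
    · exact key p q hG h hn1
    · exact (key q p hG.symm h hn2).symm
  · intro p hp hG
    refine ⟨hG, ?_⟩
    simpa [hp] using h2
  · intro q hq hG
    refine ⟨hG, ?_⟩
    simpa [hq, huv] using h3

/-- Some injective labelling of `G` has at least `k` edges between consecutive labels. -/
def HasLabelling (G : SimpleGraph V) (k : ℕ) : Prop :=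
  ∃ y : V → ℤ, y.Injective ∧ k ≤ (consecutiveSubgraph G y).edgeSet.ncard

lemma le_ncard_edgeSet_of_maximal_labelling [Finite V] {u v : V} (hy : y.Injective)
    (huv : y v = y u + 1) (hadj : ¬ G.Adj u v)
    (hmax : ∀ y' : V → ℤ, y'.Injective →
      (consecutiveSubgraph G y').edgeSet.ncard ≤ (consecutiveSubgraph G y).edgeSet.ncard) :
    (G.neighborSet u).ncard + (G.neighborSet v).ncard ≤
      (consecutiveSubgraph G y).edgeSet.ncard := by
  have huv' : u ≠ v := fun h => by rw [h] at huv; omega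
  have hone : ∀ y' : V → ℤ, y'.Injective → ∀ a b, (consecutiveSubgraph G y').Adj a b →
      ¬ (consecutiveSubgraph G y).Adj a b →
      ∃ p q, (consecutiveSubgraph G y).Adj p q ∧ ¬ (consecutiveSubgraph G y').Adj p q := by
    intro y' hy' a b h' h
    by_contra! hc
    have hsub : (consecutiveSubgraph G y).edgeSet ⊂ (consecutiveSubgraph G y').edgeSet := by
      refine ⟨SimpleGraph.edgeSet_mono fun _ _ => hc _ _, fun hs => h ?_⟩
      exact hs (show s(a, b) ∈ _ from h')
    exact absurd (Set.ncard_lt_ncard hsub (Set.toFinite _)) (not_lt.2 (hmax y' hy'))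
  have hu : ∀ w, G.Adj u w → ∃ w', G.Adj w w' ∧ y w' = y w + 1 := by
    intro w hw
    have hi : y w ≠ y u := fun h => hw.ne (hy h).symm
    obtain ⟨y', hy', h1, h2, -⟩ := exists_segment_reversed_labelling hy huv hadj hi
    by_contra! hc
    obtain ⟨p, q, hpq, hpq'⟩ := hone y' hy' u w (h2 w rfl hw) (by
      rintro ⟨-, h | h⟩
      · exact hadj (hy (h.trans huv.symm) ▸ hw)
      · exact hc u hw.symm h)
    refine hpq' (h1 p q hpq ?_ ?_)
    · rintro ⟨hp, hq⟩
      exact hc q (hy hp ▸ hpq.1) hq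
    · rintro ⟨hp, hq⟩
      exact hc p (hy hp ▸ hpq.1.symm) hq
  have hv : ∀ w, G.Adj v w → ∃ w', G.Adj w' w ∧ y w = y w' + 1 := by
    intro w hw
    have hi : y w - 1 ≠ y u := fun h => hw.ne (hy (by omega))
    obtain ⟨y', hy', h1, -, h2⟩ := exists_segment_reversed_labelling hy huv hadj hi
    by_contra! hc
    obtain ⟨p, q, hpq, hpq'⟩ := hone y' hy' v w (h2 w (by omega) hw) (by
      rintro ⟨-, h | h⟩
      · exact hc v hw h
      · exact hadj ((hy (a₁ := u) (a₂ := w) (by omega)) ▸ hw.symm))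
    refine hpq' (h1 p q hpq ?_ ?_)
    · rintro ⟨hp, hq⟩
      have : q = w := hy (by omega)
      exact hc p (this ▸ hpq.1) (by omega)
    · rintro ⟨hp, hq⟩
      have : p = w := hy (by omega)
      exact hc q (this ▸ hpq.1.symm) (by omega)
  have hcross : ∀ p q, G.Adj p q → y q = y p + 1 → G.Adj u p → ¬ G.Adj v q := by
    intro p q hG hpq hup hvq
    have hi : y p ≠ y u := fun h => hup.ne (hy h).symm
    obtain ⟨y', hy', h1, h2, h3⟩ := exists_segment_reversed_labelling hy huv hadj hi
    have hup' := h2 p rfl hup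
    have hvq' := h3 q hpq hvq
    have hnup : ¬ (consecutiveSubgraph G y).Adj u p := by
      rintro ⟨-, h | h⟩
      · exact hadj (hy (h.trans huv.symm) ▸ hup)
      · exact hadj ((hy (a₁ := q) (a₂ := u) (by omega)) ▸ hvq).symm
    have hnvq : ¬ (consecutiveSubgraph G y).Adj v q := by
      rintro ⟨-, h | h⟩
      · exact hadj ((hy (a₁ := p) (a₂ := v) (by omega)) ▸ hup)
      · exact hadj ((hy (a₁ := q) (a₂ := u) (by omega)) ▸ hvq).symm
    have hne : s(u, p) ≠ s(v, q) := by
      intro h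
      rw [Sym2.eq_iff] at h
      rcases h with h | h
      · exact huv' h.1
      · exact hadj (h.1 ▸ hvq.symm)
    have hsub : insert s(u, p) (insert s(v, q) ((consecutiveSubgraph G y).edgeSet \ {s(p, q)})) ⊆
        (consecutiveSubgraph G y').edgeSet := by
      rintro e (rfl | rfl | ⟨he, hepq⟩)
      · exact hup'
      · exact hvq'
      · induction e with
        | _ a b =>
          refine h1 a b he ?_ ?_
          · rintro ⟨ha, hb⟩
            exact hepq (by
              rw [hy ha, hy (hb.trans hpq.symm)]; rfl)
          · rintro ⟨hb, ha⟩
            exact hepq (by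
              rw [hy hb, hy (ha.trans hpq.symm), Sym2.eq_swap]; rfl)
    have hmem : s(p, q) ∈ (consecutiveSubgraph G y).edgeSet := ⟨hG, Or.inl hpq⟩
    have hcard := Set.ncard_le_ncard hsub (Set.toFinite _)
    rw [Set.ncard_insert_of_notMem, Set.ncard_insert_of_notMem] at hcard
    · have := Set.ncard_sdiff_singleton_add_one hmem (Set.toFinite _)
      have := hmax y' hy'
      omega
    · exact fun h => hnvq h.1
    · rintro (h | h)
      · exact hne h
      · exact hnup h.1
  choose! f hf using hu
  choose! g hg using hv
  rw [← Set.InjOn.ncard_image (f := fun w => s(w, f w)) (s := G.neighborSet u),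
    ← Set.InjOn.ncard_image (f := fun w => s(g w, w)) (s := G.neighborSet v),
    ← Set.ncard_union_eq]
  · apply Set.ncard_le_ncard _ (Set.toFinite _)
    rintro _ (⟨w, hw, rfl⟩ | ⟨w, hw, rfl⟩)
    · exact ⟨(hf w hw).1, Or.inl (hf w hw).2⟩
    · exact ⟨(hg w hw).1, Or.inl (hg w hw).2⟩
  · rw [Set.disjoint_left]
    rintro _ ⟨w, hw, rfl⟩ ⟨x, hx, h⟩
    have hw2 := (hf w hw).2
    have hx2 := (hg x hx).2
    dsimp only at h
    rw [Sym2.eq_iff] at h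
    rcases h with h | h
    · exact hcross w x (h.2 ▸ (hf w hw).1) (by rw [h.2]; exact hw2) hw hx
    · rw [h.1, h.2] at hx2
      omega
  · intro w hw x hx h
    have hw2 := (hg w hw).2
    have hx2 := (hg x hx).2
    dsimp only at h
    rw [Sym2.eq_iff] at h
    rcases h with h | h
    · exact h.2
    · rw [h.1, h.2] at hw2
      omega
  · intro w hw x hx h
    have hw2 := (hf w hw).2
    have hx2 := (hf x hx).2
    dsimp only at h
    rw [Sym2.eq_iff] at h
    rcases h with h | h
    · exact h.1
    · rw [← h.1, ← h.2] at hx2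
      omega

lemma degree_add_degree_lt_of_maximal [Finite V] {k : ℕ} {u v : V}
    (hG : Maximal (fun G : SimpleGraph V => ¬ HasLabelling G k) G) (huv : u ≠ v)
    (hadj : ¬ G.Adj u v) : (G.neighborSet u).ncard + (G.neighborSet v).ncard < k := by
  have hlt : ∀ y : V → ℤ, y.Injective → (consecutiveSubgraph G y).edgeSet.ncard < k :=
    fun y hy => not_le.1 fun h => hG.prop ⟨y, hy, h⟩
  have hext : HasLabelling (G ⊔ SimpleGraph.edge u v) k := by
    by_contra hc
    have := hG.2 hc le_sup_left
    exact hadj (this (Or.inr (by simp [SimpleGraph.edge_adj, huv])))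
  obtain ⟨y, hy, hk⟩ := hext
  have hsub : (consecutiveSubgraph (G ⊔ SimpleGraph.edge u v) y).edgeSet ⊆
      insert s(u, v) (consecutiveSubgraph G y).edgeSet := by
    intro e he
    induction e with
    | _ a b =>
      obtain ⟨h1 | h1, h2⟩ := he
      · exact Or.inr ⟨h1, h2⟩
      · rw [SimpleGraph.edge_adj] at h1
        left
        rcases h1.1 with ⟨rfl, rfl⟩ | ⟨rfl, rfl⟩
        · rfl
        · exact Sym2.eq_swap
  have hcons : y v = y u + 1 ∨ y u = y v + 1 := by
    by_contra hc
    have hsub' : (consecutiveSubgraph (G ⊔ SimpleGraph.edge u v) y).edgeSet ⊆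
        (consecutiveSubgraph G y).edgeSet := by
      intro e he
      rcases hsub he with rfl | h
      · exact absurd he.2 hc
      · exact h
    have := Set.ncard_le_ncard hsub' (Set.toFinite _)
    have := hlt y hy
    omega
  have hcard := (Set.ncard_le_ncard hsub (Set.toFinite _)).trans (Set.ncard_insert_le _ _)
  have hmax : ∀ y' : V → ℤ, y'.Injective →
      (consecutiveSubgraph G y').edgeSet.ncard ≤ (consecutiveSubgraph G y).edgeSet.ncard := by
    intro y' hy'
    have := hlt y' hy'
    omega
  have := hlt y hy
  rcases hcons with h | h
  · have := le_ncard_edgeSet_of_maximal_labelling hy h hadj hmax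
    omega
  · have := le_ncard_edgeSet_of_maximal_labelling hy h (fun h => hadj h.symm) hmax
    omega

end

lemma ncard_coe_image_offDiag {V : Type*} [DecidableEq V] (s : Finset V) :
    (↑(s.offDiag.image Sym2.mk.uncurry) : Set (Sym2 V)).ncard = s.card.choose 2 := by
  rw [Set.ncard_coe_finset]
  exact Sym2.card_image_offDiag s

lemma mem_image_offDiag {V : Type*} [DecidableEq V] {s : Finset V} {a b : V} :
    s(a, b) ∈ s.offDiag.image Sym2.mk.uncurry ↔ a ∈ s ∧ b ∈ s ∧ a ≠ b := by
  simp only [Finset.mem_image, Finset.mem_offDiag, Prod.exists, Function.uncurry_apply_pair,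
    Sym2.eq_iff]
  constructor
  · rintro ⟨c, d, ⟨h1, h2, h3⟩, ⟨rfl, rfl⟩ | ⟨rfl, rfl⟩⟩
    · exact ⟨h1, h2, h3⟩
    · exact ⟨h2, h1, h3.symm⟩
  · exact fun h => ⟨a, b, h, Or.inl ⟨rfl, rfl⟩⟩

lemma ncard_incidenceSet {V : Type*} [Finite V] (G : SimpleGraph V) (v : V) :
    (G.incidenceSet v).ncard = (G.neighborSet v).ncard := by
  classical
  exact Nat.card_congr (G.incidenceSetEquivNeighborSet v)

lemma ncard_edgeSet_le_of_neighborSet_le {V : Type*} [Fintype V] [DecidableEq V]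
    (G : SimpleGraph V) (B : Finset V) {t : ℕ}
    (hB : ∀ w ∈ B, (G.neighborSet w).ncard ≤ t) :
    G.edgeSet.ncard ≤ (Fintype.card V - B.card).choose 2 + B.card * t := by
  have hsub : G.edgeSet ⊆ ↑(Bᶜ.offDiag.image Sym2.mk.uncurry) ∪ ⋃ w ∈ B, G.incidenceSet w := by
    intro e he
    induction e with
    | _ a b =>
      by_cases ha : a ∈ B
      · exact Or.inr (Set.mem_biUnion ha ⟨he, by simp⟩)
      by_cases hb : b ∈ B
      · exact Or.inr (Set.mem_biUnion hb ⟨he, by simp⟩)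
      left
      rw [Finset.mem_coe, mem_image_offDiag]
      exact ⟨by simpa, by simpa, G.ne_of_adj he⟩
  refine (Set.ncard_le_ncard hsub (Set.toFinite _)).trans ((Set.ncard_union_le _ _).trans ?_)
  rw [ncard_coe_image_offDiag, Finset.card_compl]
  gcongr
  refine (Finset.set_ncard_biUnion_le B _).trans (Finset.sum_le_card_nsmul _ _ _ fun w hw => ?_)
  rw [ncard_incidenceSet]
  exact hB w hw

lemma two_mul_choose_two (a : ℕ) : (2 * a.choose 2 : ℤ) = a * (a - 1) := by
  induction a with
  | zero => simp
  | succ a ih =>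
    rw [Nat.choose_succ_succ' a 1, Nat.choose_one_right]
    push_cast
    linarith

lemma choose_two_add_mul_le_max {n k t : ℕ} (hkn : k ≤ n) (ht : 2 * t + 1 ≤ k) :
    (k - t).choose 2 + (n - k + t) * t ≤
      max (k.choose 2) (n.choose 2 - (n - (k - 1) / 2).choose 2 + if Odd k then 0 else 1) := by
  obtain ⟨s, hs, hsk⟩ : ∃ s, (k - 1) / 2 = s ∧
      (Odd k ∧ k = 2 * s + 1 ∨ ¬ Odd k ∧ k = 2 * s + 2) := by
    refine ⟨_, rfl, ?_⟩
    rcases Nat.even_or_odd k with h | h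
    · right
      refine ⟨Nat.not_odd_iff_even.2 h, ?_⟩
      obtain ⟨r, rfl⟩ := h
      omega
    · left
      refine ⟨h, ?_⟩
      obtain ⟨r, rfl⟩ := h
      omega
  rw [hs]
  have hts : t ≤ s := by omega
  obtain ⟨m, rfl⟩ := Nat.exists_eq_add_of_le hkn
  have hle : (k + m - s).choose 2 ≤ (k + m).choose 2 := Nat.choose_le_choose 2 (by omega)
  have e1 := two_mul_choose_two (k - t)
  have e2 := two_mul_choose_two k
  have e3 := two_mul_choose_two (k + m)
  have e4 := two_mul_choose_two (k + m - s)
  rw [Nat.cast_sub (by omega)] at e1 e4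
  rw [le_max_iff]
  zify [hle]
  rw [show k + m - k = m by omega]
  push_cast at *
  by_cases hc : 3 * (t : ℤ) + 2 * m + 1 ≤ 2 * k
  · left
    nlinarith [mul_nonneg (Int.natCast_nonneg t) (sub_nonneg.2 hc)]
  · right
    have hst : (0 : ℤ) ≤ (s - t) * (3 * (s + t) + 2 * m + 1 - 2 * k) :=
      mul_nonneg (by omega) (by omega)
    rcases hsk with ⟨ho, rfl⟩ | ⟨ho, rfl⟩
    · rw [if_pos ho]
      push_cast at *
      linarith
    · rw [if_neg ho]
      push_cast at *
      linarith

lemma hasLabelling_top {n k : ℕ} (hkn : k ≤ n - 1) :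
    HasLabelling (⊤ : SimpleGraph (Fin n)) k := by
  have hy : (fun i : Fin n => (i : ℤ)).Injective := fun i j h => by
    simpa [Fin.ext_iff] using h
  refine ⟨_, hy, hkn.trans ?_⟩
  let f : Fin (n - 1) → Sym2 (Fin n) := fun i =>
    s(⟨i, by omega⟩, ⟨i + 1, by omega⟩)
  have hf : f.Injective := by
    intro i j h
    simp only [f, Sym2.eq_iff, Fin.mk.injEq] at h
    omega
  calc n - 1 = (Set.range f).ncard := by
        rw [← Set.image_univ, Set.ncard_image_of_injective _ hf, Set.ncard_univ, Nat.card_fin]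
    _ ≤ _ := by
        refine Set.ncard_le_ncard ?_ (Set.toFinite _)
        rintro _ ⟨i, rfl⟩
        refine ⟨by simp [Fin.ext_iff], Or.inl ?_⟩
        push_cast
        rfl

theorem ncard_edgeSet_le_of_not_hasLabelling {n k : ℕ} (hkn : k ≤ n - 1)
    {G : SimpleGraph (Fin n)} (hG : ¬ HasLabelling G k) :
    G.edgeSet.ncard ≤ max (k.choose 2)
      (n.choose 2 - (n - (k - 1) / 2).choose 2 + if Odd k then 0 else 1) := by
  obtain ⟨H, hGH, hH⟩ := Finite.exists_le_maximal (p := fun G => ¬ HasLabelling G k) hG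
  refine (Set.ncard_le_ncard (SimpleGraph.edgeSet_mono hGH) (Set.toFinite _)).trans ?_
  let deg : Fin n → ℕ := fun v => (H.neighborSet v).ncard
  let S : Set (Fin n × Fin n) := {p | p.1 ≠ p.2 ∧ ¬ H.Adj p.1 p.2 ∧ deg p.1 ≤ deg p.2}
  have hS : S.Nonempty := by
    have hne : H ≠ ⊤ := by
      rintro rfl
      exact hH.prop (hasLabelling_top hkn)
    obtain ⟨u, v, huv, hadj⟩ := SimpleGraph.ne_top_iff_exists_not_adj.1 hne
    rcases le_total (deg u) (deg v) with h | h
    · exact ⟨(u, v), huv, hadj, h⟩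
    · exact ⟨(v, u), huv.symm, fun h => hadj h.symm, h⟩
  obtain ⟨⟨u, v⟩, ⟨huv, hadj, hle⟩, hmax⟩ :=
    S.toFinite.exists_maximalFor (fun p => deg p.1 + deg p.2) S hS
  dsimp only at huv hadj hle hmax
  have hlt : deg u + deg v < k := degree_add_degree_lt_of_maximal hH huv hadj
  have hdeg : ∀ w, w ≠ v → ¬ H.Adj w v → deg w ≤ deg u := by
    intro w hw hadj'
    by_contra! hc
    rcases le_total (deg w) (deg v) with h | h
    · have := hmax (j := (w, v)) ⟨hw, hadj', h⟩ (by dsimp only; omega)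
      dsimp only at this
      omega
    · have := hmax (j := (v, w)) ⟨hw.symm, fun h => hadj' h.symm, h⟩ (by dsimp only; omega)
      dsimp only at this
      omega
  have hcard : n - k + deg u ≤ ((insert v (H.neighborSet v))ᶜ).ncard := by
    have h1 := Set.ncard_add_ncard_compl (insert v (H.neighborSet v))
    have h2 := Set.ncard_insert_le v (H.neighborSet v)
    rw [Nat.card_fin] at h1
    change _ ≤ deg v + 1 at h2
    omega
  obtain ⟨B, hB, hBcard⟩ := Set.exists_subset_card_eq hcard
  lift B to Finset (Fin n) using Set.toFinite _
  rw [Set.ncard_coe_finset] at hBcard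
  have := ncard_edgeSet_le_of_neighborSet_le H B (t := deg u) fun w hw => by
    have := hB hw
    rw [Set.mem_compl_iff, Set.mem_insert_iff, not_or] at this
    exact hdeg w this.1 fun h => this.2 h.symm
  rw [hBcard, Fintype.card_fin, show n - (n - k + deg u) = k - deg u by omega] at this
  exact this.trans (choose_two_add_mul_le_max (by omega) (by omega))

lemma ncard_edgeSet_lt_of_isAcyclic {V : Type*} [Finite V] [Nonempty V] {F : SimpleGraph V}
    (hF : F.IsAcyclic) : F.edgeSet.ncard < Nat.card V := by
  classical
  have := Fintype.ofFinite V
  obtain ⟨T, hFT, -, hT⟩ :=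
    SimpleGraph.connected_top.exists_isTree_le_of_le_of_isAcyclic (le_top (a := F)) hF
  have h1 := Set.ncard_le_ncard (SimpleGraph.edgeSet_mono hFT) (Set.toFinite _)
  have h2 := hT.card_edgeFinset
  rw [← Set.ncard_coe_finset, SimpleGraph.coe_edgeFinset] at h2
  rw [Nat.card_eq_fintype_card]
  omega

lemma ncard_edgeSet_lt_of_isAcyclic_of_support {V : Type*} {F : SimpleGraph V}
    (hF : F.IsAcyclic) {s : Finset V} (hs : s.Nonempty) (hFs : ∀ a b, F.Adj a b → a ∈ s) :
    F.edgeSet.ncard < s.card := by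
  have : Nonempty (s : Set V) := hs.to_subtype
  have h := ncard_edgeSet_lt_of_isAcyclic (hF.induce (s : Set V))
  rw [Nat.card_coe_set_eq, Set.ncard_coe_finset] at h
  refine lt_of_le_of_lt ?_ h
  rw [← Set.ncard_image_of_injective _ (Sym2.map.injective Subtype.val_injective)]
  refine Set.ncard_le_ncard ?_ ((Set.toFinite _).image _)
  intro e he
  induction e with
  | _ a b => exact ⟨s(⟨a, hFs a b he⟩, ⟨b, hFs b a he.symm⟩), he, rfl⟩

lemma exists_graph_ncard_eq_choose {n k : ℕ} (hk : 1 ≤ k) (hkn : k ≤ n) :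
    ∃ G : SimpleGraph (Fin n),
      (¬ ∃ F ≤ G, IsLinearForest F ∧ F.edgeSet.ncard = k) ∧ G.edgeSet.ncard = k.choose 2 := by
  let s : Finset (Fin n) := Finset.univ.filter (fun i => (i : ℕ) < k)
  have hs : s.card = k := by
    rw [Fin.card_filter_val_lt, min_eq_right hkn]
  refine ⟨SimpleGraph.fromEdgeSet ↑(s.offDiag.image Sym2.mk.uncurry), ?_, ?_⟩
  · rintro ⟨F, hFG, hF, hFk⟩
    have := ncard_edgeSet_lt_of_isAcyclic_of_support hF.1 (s := s)
      (Finset.card_pos.1 (by omega)) fun a b hab => (mem_image_offDiag.1 (hFG hab).1).1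
    omega
  · rw [SimpleGraph.edgeSet_fromEdgeSet, sdiff_eq_left.2, ncard_coe_image_offDiag, hs]
    rw [Set.disjoint_left]
    intro e he
    induction e with
    | _ a b => simpa using (mem_image_offDiag.1 he).2.2

lemma exists_graph_ncard_eq_sub_add {n k : ℕ} (hk : 1 ≤ k) (hkn : k ≤ n - 1) :
    ∃ G : SimpleGraph (Fin n),
      (¬ ∃ F ≤ G, IsLinearForest F ∧ F.edgeSet.ncard = k) ∧ G.edgeSet.ncard =
        n.choose 2 - (n - (k - 1) / 2).choose 2 + if Odd k then 0 else 1 := by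
  obtain ⟨s, hs⟩ : ∃ s, s = (k - 1) / 2 := ⟨_, rfl⟩
  rw [← hs]
  let S : Finset (Fin n) := Finset.univ.filter (fun i => (i : ℕ) < s)
  have hS : S.card = s := by
    rw [Fin.card_filter_val_lt, min_eq_right (by omega)]
  let x : Sym2 (Fin n) := s(⟨n - 2, by omega⟩, ⟨n - 1, by omega⟩)
  let X : Set (Sym2 (Fin n)) := if Odd k then ∅ else {x}
  have hX : X.ncard = if Odd k then 0 else 1 := by
    simp only [X]
    split_ifs <;> simp
  have hXdiag : ∀ e ∈ X, e = x := by
    simp only [X]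
    split_ifs <;> simp
  let A : Set (Sym2 (Fin n)) := ↑((Finset.univ : Finset (Fin n)).offDiag.image Sym2.mk.uncurry)
  let B : Set (Sym2 (Fin n)) := ↑(Sᶜ.offDiag.image Sym2.mk.uncurry)
  have hBA : B ⊆ A := by
    intro e he
    induction e with
    | _ a b => exact mem_image_offDiag.2 ⟨by simp, by simp, (mem_image_offDiag.1 he).2.2⟩
  refine ⟨SimpleGraph.fromEdgeSet (A \ B ∪ X), ?_, ?_⟩
  · rintro ⟨F, hFG, hF, hFk⟩
    have hsub : F.edgeSet ⊆ (⋃ w ∈ S, F.incidenceSet w) ∪ X := by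
      intro e he
      induction e with
      | _ a b =>
        rcases (hFG he).1 with h | h
        · left
          have h2 : ¬ (a ∈ Sᶜ ∧ b ∈ Sᶜ ∧ a ≠ b) := fun h' => h.2 (mem_image_offDiag.2 h')
          by_cases ha : a ∈ S
          · exact Set.mem_biUnion ha ⟨he, by simp⟩
          by_cases hb : b ∈ S
          · exact Set.mem_biUnion hb ⟨he, by simp⟩
          exact absurd ⟨by simpa, by simpa, F.ne_of_adj he⟩ h2
        · exact Or.inr h
    have h1 := (Set.ncard_le_ncard hsub (Set.toFinite _)).trans (Set.ncard_union_le _ _)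
    have h2 : (⋃ w ∈ S, F.incidenceSet w).ncard ≤ S.card * 2 :=
      (Finset.set_ncard_biUnion_le S _).trans (Finset.sum_le_card_nsmul _ _ _ fun w _ => by
        rw [ncard_incidenceSet]
        exact hF.2 w)
    rw [hX] at h1
    split_ifs at h1 with ho
    · omega
    · rw [Nat.not_odd_iff_even] at ho
      obtain ⟨r, rfl⟩ := ho
      omega
  · have hdisj : Disjoint (A \ B) X := by
      rw [Set.disjoint_right]
      intro e he h
      refine h.2 ?_
      rw [hXdiag e he]
      refine mem_image_offDiag.2 ⟨?_, ?_, ?_⟩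
      · simp only [S, Finset.mem_compl, Finset.mem_filter_univ]
        omega
      · simp only [S, Finset.mem_compl, Finset.mem_filter_univ]
        omega
      · simp only [ne_eq, Fin.mk.injEq]
        omega
    rw [SimpleGraph.edgeSet_fromEdgeSet, sdiff_eq_left.2, Set.ncard_union_eq hdisj, hX,
      Set.ncard_sdiff hBA, ncard_coe_image_offDiag, ncard_coe_image_offDiag, Finset.card_compl, hS,
      Finset.card_univ, Fintype.card_fin]
    rw [Set.disjoint_left]
    rintro e (he | he)
    · induction e with
      | _ a b => simpa using (mem_image_offDiag.1 he.1).2.2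
    · rw [hXdiag e he]
      simp only [x, Sym2.mem_diagSet, Sym2.mk_isDiag_iff, Fin.mk.injEq]
      omega

theorem stmt_0 (n k : ℕ) (hk : 1 ≤ k) (hkn : k ≤ n - 1) :
    IsGreatest
      {m : ℕ | ∃ G : SimpleGraph (Fin n),
        (¬ ∃ F : SimpleGraph (Fin n), F ≤ G ∧ IsLinearForest F ∧ F.edgeSet.ncard = k) ∧
        G.edgeSet.ncard = m}
      (max (Nat.choose k 2)
        (Nat.choose n 2 - Nat.choose (n - (k - 1) / 2) 2 + if Odd k then 0 else 1)) := by
  constructor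
  · rcases max_choice (Nat.choose k 2)
      (Nat.choose n 2 - Nat.choose (n - (k - 1) / 2) 2 + if Odd k then 0 else 1) with h | h
    · rw [h]
      exact exists_graph_ncard_eq_choose hk (by omega)
    · rw [h]
      exact exists_graph_ncard_eq_sub_add hk hkn
  · rintro m ⟨G, hG, rfl⟩
    refine ncard_edgeSet_le_of_not_hasLabelling hkn fun ⟨y, hy, hyk⟩ => hG ?_
    exact exists_isLinearForest_of_le_ncard hy hyk
end

section
/- For all integers n and k with 1 ≤ k ≤ n−1, every graph G on n vertices containing no linear forest with k edges satisfies e(G) ≤ max{ C(k,2), C(n,2) − C(n−⌊(k−1)/2⌋, 2) + c }, where c = 0 if k is odd and c = 1 if k is even. -/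
open Classical in
/-- The number of consecutive pairs of `l` that are adjacent in `G`. -/
noncomputable def SimpleGraph.chainScore {V : Type*} (G : SimpleGraph V) : List V → ℕ
  | [] => 0
  | [_] => 0
  | a :: b :: l => (if G.Adj a b then 1 else 0) + G.chainScore (b :: l)

namespace SimpleGraph
variable {V : Type*} (G : SimpleGraph V)

open Classical in
/-- The contribution to `chainScore` of the junction between two concatenated lists. -/
noncomputable def junctionScore : Option V → Option V → ℕ
  | some a, some b => if G.Adj a b then 1 else 0
  | _, _ => 0

lemma chainScore_append (X Y : List V) :
    G.chainScore (X ++ Y) =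
      G.chainScore X + G.junctionScore X.getLast? Y.head? + G.chainScore Y := by
  induction X with
  | nil => simp [chainScore, junctionScore]
  | cons a X ih =>
    cases X with
    | nil => cases Y <;> simp [chainScore, junctionScore]
    | cons b X =>
      simp only [List.cons_append, chainScore] at ih ⊢
      rw [ih, List.getLast?_cons_cons]
      ring

lemma chainScore_reverse (X : List V) : G.chainScore X.reverse = G.chainScore X := by
  induction X with
  | nil => rfl
  | cons a X ih =>
    rw [List.reverse_cons, chainScore_append, ih, ← List.singleton_append, chainScore_append]
    cases X with
    | nil => simp [chainScore, junctionScore]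
    | cons b X =>
      simp [chainScore, junctionScore, add_comm]
      rw [G.adj_comm]

/-- If `f a + g b` is at most the score of `[a, b]` for all consecutive entries `a, b` of `l`, and the
boundary terms vanish, then the sums of `f` and `g` over `l` add up to at most the score of `l`. -/
lemma sum_map_add_sum_map_le_chainScore (f g : V → ℕ) (l : List V)
    (h : ∀ P a b Q, l = P ++ a :: b :: Q → f a + g b ≤ G.chainScore [a, b])
    (hhead : ∀ a ∈ l.head?, g a = 0) (hlast : ∀ a ∈ l.getLast?, f a = 0) :
    (l.map f).sum + (l.map g).sum ≤ G.chainScore l := by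
  suffices H : (l.map f).sum + (l.tail.map g).sum ≤ G.chainScore l by
    cases l with
    | nil => simp
    | cons a l => simpa [hhead a (by simp)] using H
  clear hhead
  induction l with
  | nil => simp
  | cons a l ih =>
    cases l with
    | nil => simp [hlast a (by simp)]
    | cons b l =>
      have h1 := ih (fun P c d Q e => h (a :: P) c d Q (by simp [e]))
        (fun c hc => hlast c (by simpa using hc))
      have h2 := h [] a b l rfl
      simp [chainScore] at h1 h2 ⊢
      omega

lemma chainScore_sup_edge_of_notMem (u v : V) (l : List V) (h : u ∉ l ∨ v ∉ l) :
    (G ⊔ edge u v).chainScore l = G.chainScore l := by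
  induction l with
  | nil => rfl
  | cons a l ih =>
    cases l with
    | nil => rfl
    | cons b l =>
      have h1 := ih (by simp at h ⊢; tauto)
      have h2 : (G ⊔ edge u v).Adj a b ↔ G.Adj a b := by
        simp [edge_adj] at h ⊢; grind
      simp only [chainScore, h1]
      congr 1
      split_ifs <;> tauto

lemma exists_append_of_chainScore_sup_edge_ne (u v : V) (l : List V)
    (h : (G ⊔ edge u v).chainScore l ≠ G.chainScore l) :
    ∃ A C, l = A ++ u :: v :: C ∨ l = A ++ v :: u :: C := by
  induction l with
  | nil => simp [chainScore] at h
  | cons a l ih =>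
    cases l with
    | nil => simp [chainScore] at h
    | cons b l =>
      by_cases h1 : (G ⊔ edge u v).chainScore (b :: l) = G.chainScore (b :: l)
      · refine ⟨[], l, ?_⟩
        by_contra h2
        refine h ?_
        have h2 : (G ⊔ edge u v).Adj a b ↔ G.Adj a b := by
          simp [edge_adj] at h2 ⊢; grind
        simp only [chainScore, h1]
        congr 1
        split_ifs <;> tauto
      · obtain ⟨A, C, h2⟩ := ih h1
        exact ⟨a :: A, C, by simpa using h2⟩

open Classical in
lemma sum_map_adj_eq_degree [Fintype V] (u : V) (l : List V) (hl : l.Nodup) (hm : ∀ x, x ∈ l) :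
    (l.map fun x => if G.Adj u x then 1 else 0).sum = G.degree u := by
  rw [← List.sum_toFinset _ hl, ← card_neighborFinset_eq_degree, Finset.card_eq_sum_ones,
    neighborFinset_eq_filter, Finset.sum_filter]
  congr 1
  ext; simp [hm]

open Classical in
lemma degree_add_degree_lt [Fintype V] {k : ℕ}
    (hG : ∀ l : List V, l.Nodup → (∀ x, x ∈ l) → G.chainScore l < k)
    {u v : V} {A C : List V} (hnd : (A ++ u :: v :: C).Nodup) (hm : ∀ x, x ∈ A ++ u :: v :: C)
    (huv : ¬ G.Adj u v)
    (hk : k ≤ (G ⊔ edge u v).chainScore (A ++ u :: v :: C)) :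
    G.degree u + G.degree v < k := by
  have hsplit : ∀ H : SimpleGraph V, H.chainScore (A ++ u :: v :: C) =
      H.chainScore (A ++ [u]) + (if H.Adj u v then 1 else 0) + H.chainScore (v :: C) := by
    intro H
    rw [show A ++ u :: v :: C = (A ++ [u]) ++ (v :: C) by simp, chainScore_append]
    simp [junctionScore]
  have hne : u ≠ v := by rintro rfl; simp [List.nodup_append] at hnd
  have hk' : k ≤ G.chainScore (A ++ [u]) + 1 + G.chainScore (v :: C) := by
    rw [hsplit, chainScore_sup_edge_of_notMem, chainScore_sup_edge_of_notMem] at hk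
    · exact hk.trans (by gcongr; split <;> simp)
    · left; grind
    · right; grind
  have key : ∀ l : List V, l.Perm (A ++ u :: v :: C) →
      G.chainScore l ≤ G.chainScore (A ++ [u]) + G.chainScore (v :: C) := by
    intro l hl
    have := hG l (hl.nodup_iff.2 hnd) (fun x => hl.mem_iff.2 (hm x))
    omega
  set f : V → ℕ := fun x => if G.Adj u x then 1 else 0 with hf
  set g : V → ℕ := fun x => if G.Adj v x then 1 else 0 with hg
  have h1 : ((A ++ [u]).map f).sum + ((A ++ [u]).map g).sum ≤ G.chainScore (A ++ [u]) := by
    apply sum_map_add_sum_map_le_chainScore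
    · intro P a b Q e
      have hlast : (b :: Q).getLast? = some u := by
        have := congrArg List.getLast? e
        simpa using this.symm
      have := key ((P ++ [a]) ++ ((b :: Q).reverse ++ v :: C)) (by
        rw [show A ++ u :: v :: C = (A ++ [u]) ++ (v :: C) by simp, e]
        simp only [List.append_assoc]
        refine List.Perm.append_left _ ?_
        exact ((List.reverse_perm (b :: Q)).append_right (v :: C)).cons a)
      rw [e, show P ++ a :: b :: Q = (P ++ [a]) ++ (b :: Q) by simp] at this
      simp only [chainScore_append, chainScore_reverse, List.head?_append, List.head?_reverse,
        List.getLast?_reverse, hlast] at this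
      simp [junctionScore, chainScore, hf, hg] at this ⊢
      simp only [G.adj_comm u a, G.adj_comm v b]
      omega
    · intro a ha
      have := key ((A ++ [u]).reverse ++ v :: C) (by
        rw [show A ++ u :: v :: C = (A ++ [u]) ++ (v :: C) by simp]
        exact (List.reverse_perm _).append_right _)
      rw [chainScore_append, chainScore_reverse, List.getLast?_reverse, ha] at this
      simp [junctionScore, hg] at this ⊢
      grind [G.adj_comm]
    · simp [hf]
  have h2 : ((v :: C).map f).sum + ((v :: C).map g).sum ≤ G.chainScore (v :: C) := by
    apply sum_map_add_sum_map_le_chainScore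
    · intro P a b Q e
      have hhead : (P ++ [a]).head? = some v := by
        have := congrArg List.head? e
        cases P <;> simp_all
      have := key ((A ++ [u]) ++ ((P ++ [a]).reverse ++ b :: Q)) (by
        rw [show A ++ u :: v :: C = (A ++ [u]) ++ (v :: C) by simp, e,
          show P ++ a :: b :: Q = (P ++ [a]) ++ (b :: Q) by simp]
        refine List.Perm.append_left _ ?_
        exact (List.reverse_perm _).append_right _)
      rw [e, show P ++ a :: b :: Q = (P ++ [a]) ++ (b :: Q) by simp] at this
      rw [chainScore_append, chainScore_append _ (P ++ [a]).reverse, chainScore_reverse,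
        chainScore_append _ (P ++ [a]), List.getLast?_reverse, hhead, List.head?_append,
        List.head?_reverse] at this
      simp [junctionScore, chainScore, hf, hg] at this ⊢
      omega
    · simp [hg]
    · intro a ha
      have := key ((A ++ [u]) ++ (v :: C).reverse) (by
        rw [show A ++ u :: v :: C = (A ++ [u]) ++ (v :: C) by simp]
        exact (List.reverse_perm _).append_left _)
      rw [chainScore_append, chainScore_reverse, List.head?_reverse, ha] at this
      simp [junctionScore, hf] at this ⊢
      grind
  have e1 : ((A ++ u :: v :: C).map f).sum = _ := G.sum_map_adj_eq_degree u _ hnd hm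
  have e2 : ((A ++ u :: v :: C).map g).sum = _ := G.sum_map_adj_eq_degree v _ hnd hm
  rw [show A ++ u :: v :: C = (A ++ [u]) ++ (v :: C) by simp, List.map_append,
    List.sum_append] at e1 e2
  have := hG _ hnd hm
  rw [hsplit] at this
  simp only [huv, if_false] at this
  omega

lemma exists_isLinearForest_of_le_chainScore [Finite V] (l : List V) (hl : l.Nodup) (k : ℕ)
    (hk : k ≤ G.chainScore l) :
    ∃ F ≤ G, IsLinearForest F ∧ F.edgeSet.ncard = k ∧ (∀ x y, F.Adj x y → x ∈ l) ∧
      ∀ x ∈ l.head?, (F.neighborSet x).ncard ≤ 1 := by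
  induction l generalizing k with
  | nil =>
    obtain rfl : k = 0 := by simpa [chainScore] using hk
    exact ⟨⊥, bot_le, ⟨isAcyclic_bot, by simp⟩, by simp, by simp, by simp⟩
  | cons a l ih =>
    cases l with
    | nil =>
      obtain rfl : k = 0 := by simpa [chainScore] using hk
      exact ⟨⊥, bot_le, ⟨isAcyclic_bot, by simp⟩, by simp, by simp, by simp⟩
    | cons b l =>
      have hl' : (b :: l).Nodup := hl.of_cons
      have ha : a ∉ b :: l := (List.nodup_cons.1 hl).1
      by_cases hk' : k ≤ G.chainScore (b :: l)
      · obtain ⟨F, hF, hlin, hcard, hsupp, -⟩ := ih hl' k hk'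
        refine ⟨F, hF, hlin, hcard, fun x y h => List.mem_cons_of_mem _ (hsupp x y h), ?_⟩
        have : F.neighborSet a = ∅ := by
          ext y; simpa using fun h => ha (hsupp a y h)
        simp [this]
      · have hadj : G.Adj a b := by
          by_contra h
          simp [chainScore, h] at hk hk'
          omega
        obtain ⟨k, rfl⟩ : ∃ j, k = j + 1 := ⟨k - 1, by omega⟩
        obtain ⟨F, hF, hlin, hcard, hsupp, hhead⟩ := ih hl' k (by
          simp [chainScore, hadj] at hk; omega)
        have hFa : ∀ y, ¬ F.Adj a y := fun y h => ha (hsupp a y h)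
        have hab : a ≠ b := hadj.ne
        have hna : (F ⊔ edge a b).neighborSet a = {b} := by
          ext y; simp [edge_adj, hFa]; grind
        have hnb : (F ⊔ edge a b).neighborSet b = insert a (F.neighborSet b) := by
          ext y; simp [edge_adj]; grind
        have hn : ∀ x, x ≠ a → x ≠ b → (F ⊔ edge a b).neighborSet x = F.neighborSet x := by
          intro x hxa hxb; ext y; simp [edge_adj]; grind
        refine ⟨F ⊔ edge a b, sup_le hF ?_, ⟨?_, fun x => ?_⟩, ?_, fun x y h => ?_, ?_⟩
        · exact (edge_le_iff _).2 (.inr hadj)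
        · refine IsAcyclic.sup_edge_of_not_reachable (fun ⟨p⟩ => ?_) hlin.1
          cases p with
          | nil => exact hab rfl
          | cons h _ => exact hFa _ h
        · by_cases hxa : x = a
          · simp [hxa, hna]
          by_cases hxb : x = b
          · subst hxb
            rw [hnb]
            have := hhead x (by simp)
            exact (Set.ncard_insert_le _ _).trans (by omega)
          · rw [hn x hxa hxb]; exact hlin.2 x
        · rw [edgeSet_sup, edgeSet_edge_of_ne hab, Set.union_singleton, Set.ncard_insert_of_notMem,
            hcard]
          simpa using hFa b
        · rcases h with h | h
          · exact List.mem_cons_of_mem _ (hsupp x y h)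
          · simp [edge_adj] at h ⊢; grind
        · intro x hx
          obtain rfl : a = x := by simpa using hx
          rw [hna, Set.ncard_singleton]

open Classical in
/-- Degree-sum bound for a graph closed under the Ore-type condition at level `k`. -/
lemma exists_two_mul_card_edgeFinset_le [Fintype V] {k : ℕ} (hk : k < Fintype.card V)
    (hne : ∃ u v, u ≠ v ∧ ¬ G.Adj u v)
    (hG : ∀ u v, u ≠ v → ¬ G.Adj u v → G.degree u + G.degree v < k) :
    ∃ s : ℕ, 2 * s + 1 ≤ k ∧ (2 * G.edgeFinset.card : ℤ) ≤
      s * (Fintype.card V - k + s) + (k - 2 * s) * (k - 1 - s) + s * (Fintype.card V - 1) := by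
  obtain ⟨⟨u, v⟩, huv, hmax⟩ := Finset.exists_max_image
    (Finset.univ.filter fun p : V × V => p.1 ≠ p.2 ∧ ¬ G.Adj p.1 p.2)
    (fun p => G.degree p.1 + G.degree p.2) (by
      obtain ⟨u, v, h⟩ := hne
      exact ⟨(u, v), by simpa using h⟩)
  simp only [Finset.mem_filter, Finset.mem_univ, true_and, Prod.forall] at huv hmax
  wlog hle : G.degree u ≤ G.degree v generalizing u v
  · refine this v u ⟨Ne.symm huv.1, fun h => huv.2 h.symm⟩ (fun a b h => ?_) (by omega)
    have := hmax a b h; omega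
  have hlt := hG u v huv.1 huv.2
  set s := G.degree u with hs
  set A : Finset V := Finset.univ.filter fun w => w ≠ v ∧ ¬ G.Adj v w with hA
  set B : Finset V := G.neighborFinset u \ A with hB
  have hbound : ∀ w, (G.degree w : ℤ) ≤ (k - 1 - s) + (if w ∈ A then (2 * s + 1 - k : ℤ) else 0) +
      (if w ∈ B then (Fintype.card V - k + s : ℤ) else 0) := by
    intro w
    by_cases hwA : w ∈ A
    · have hwB : w ∉ B := by simp [hB, hwA]
      simp only [hA, Finset.mem_filter, Finset.mem_univ, true_and] at hwA
      have := hmax w v ⟨hwA.1, fun h => hwA.2 h.symm⟩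
      simp only [hA, hwA, hwB, Finset.mem_filter, Finset.mem_univ, true_and]
      simp
      omega
    · by_cases hwB : w ∈ B
      · have := G.degree_lt_card_verts w
        simp only [hwA, hwB, if_true, if_false]
        omega
      · simp only [hwA, hwB, if_false]
        have hwu : w ≠ u := by
          rintro rfl
          exact hwA (by simpa [hA, huv.1] using fun h : G.Adj v w => huv.2 h.symm)
        have : ¬ G.Adj u w := by
          intro h; exact hwB (by simp [hB, hwA, h])
        have := hmax u w ⟨hwu.symm, this⟩
        omega
  have hsum : (2 * G.edgeFinset.card : ℤ) ≤ Fintype.card V * (k - 1 - s) +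
      A.card * (2 * s + 1 - k) + B.card * (Fintype.card V - k + s) := by
    have h1 : (2 * G.edgeFinset.card : ℤ) = ∑ w, (G.degree w : ℤ) := by
      exact_mod_cast G.sum_degrees_eq_twice_card_edges.symm
    rw [h1]
    refine (Finset.sum_le_sum fun w _ => hbound w).trans_eq ?_
    simp [Finset.sum_add_distrib, Finset.sum_ite_mem]
    linarith
  have hBcard : B.card ≤ s := by
    rw [hs, ← card_neighborFinset_eq_degree]
    exact Finset.card_le_card Finset.sdiff_subset
  have hAcard : Fintype.card V ≤ A.card + (G.degree v + 1) := by
    have : (Finset.univ : Finset V) ⊆ A ∪ insert v (G.neighborFinset v) := by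
      intro w _; simp [hA]; tauto
    have := (Finset.card_le_card this).trans (Finset.card_union_le _ _)
    have h2 := Finset.card_insert_le v (G.neighborFinset v)
    rw [card_neighborFinset_eq_degree] at h2
    rw [Finset.card_univ] at this
    omega
  refine ⟨s, by omega, hsum.trans ?_⟩
  have h1 : (A.card : ℤ) * (k - 2 * s - 1) ≥ (Fintype.card V - k + s) * (k - 2 * s - 1) := by
    apply mul_le_mul_of_nonneg_right <;> omega
  have h2 : (B.card : ℤ) * (Fintype.card V - k + s) ≤ s * (Fintype.card V - k + s) := by
    apply mul_le_mul_of_nonneg_right <;> omega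
  nlinarith

end SimpleGraph

/-- A convex quadratic in `s` is bounded by its values at the endpoints of `[0, (k - 1) / 2]`. -/
lemma le_max_choose_of_two_mul_le {n k s e : ℕ} (hkn : k < n) (hs : 2 * s + 1 ≤ k)
    (h : (2 * e : ℤ) ≤ s * (n - k + s) + (k - 2 * s) * (k - 1 - s) + s * (n - 1)) :
    e ≤ max (Nat.choose k 2)
      (Nat.choose n 2 - Nat.choose (n - (k - 1) / 2) 2 + if Odd k then 0 else 1) := by
  have hc : ∀ m : ℕ, (2 * m.choose 2 : ℤ) = m * (m - 1) := by
    intro m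
    cases m with
    | zero => simp
    | succ m =>
      have h1 := Nat.add_one_mul_choose_eq m 1
      push_cast
      simp only [Nat.choose_one_right] at h1
      zify at h1
      linarith
  rw [le_max_iff]
  by_cases hcase : (3 * s + 2 * n + 1 - 4 * k : ℤ) ≤ 0
  · left
    zify
    have := hc k
    have : (s : ℤ) * (3 * s + 2 * n + 1 - 4 * k) ≤ 0 :=
      mul_nonpos_of_nonneg_of_nonpos (by positivity) hcase
    nlinarith
  · right
    obtain ⟨t, ht⟩ : ∃ t, t = (k - 1) / 2 := ⟨_, rfl⟩
    rw [← ht]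
    have h1 := hc n
    have h2 := hc (n - t)
    rw [Nat.cast_sub (by omega)] at h2
    have hmono : (n - t).choose 2 ≤ n.choose 2 := Nat.choose_le_choose _ (by omega)
    have h3 : (0 : ℤ) ≤ (t - s) * (3 * (t + s) + 2 * n + 1 - 4 * k) :=
      mul_nonneg (by omega) (by omega)
    zify [hmono]
    split_ifs with hodd
    · obtain ⟨j, rfl⟩ := hodd
      obtain rfl : t = j := by omega
      push_cast at *
      nlinarith
    · rw [Nat.not_odd_iff_even] at hodd
      obtain ⟨j, rfl⟩ := hodd
      obtain rfl : j = t + 1 := by omega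
      push_cast at *
      nlinarith

theorem stmt_1 (n k : ℕ) (hk : 1 ≤ k) (hkn : k ≤ n - 1) (G : SimpleGraph (Fin n))
    (hfree : ¬ ∃ F : SimpleGraph (Fin n), F ≤ G ∧ IsLinearForest F ∧ F.edgeSet.ncard = k) :
    G.edgeSet.ncard ≤
      max (Nat.choose k 2)
        (Nat.choose n 2 - Nat.choose (n - (k - 1) / 2) 2 + if Odd k then 0 else 1) := by
  classical
  let Free : SimpleGraph (Fin n) → Prop := fun H =>
    ∀ l : List (Fin n), l.Nodup → (∀ x, x ∈ l) → H.chainScore l < k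
  have hGfree : Free G := by
    intro l hl _
    by_contra h
    obtain ⟨F, hF, hlin, hcard, -⟩ :=
      G.exists_isLinearForest_of_le_chainScore l hl k (not_lt.1 h)
    exact hfree ⟨F, hF, hlin, hcard⟩
  obtain ⟨H, hGH, hH⟩ := Finite.exists_le_maximal hGfree
  have hne : ∃ u v, u ≠ v ∧ ¬ H.Adj u v := by
    by_contra! hcomplete
    have hscore : ∀ l : List (Fin n), l.Nodup → l.length ≤ H.chainScore l + 1 := by
      intro l hl
      induction l with
      | nil => simp
      | cons a l ih =>
        cases l with
        | nil => simp
        | cons b l =>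
          have := ih hl.of_cons
          have hab : H.Adj a b := hcomplete a b (by rintro rfl; simp at hl)
          simp [SimpleGraph.chainScore, hab] at this ⊢
          omega
    have h1 := hscore _ (List.nodup_finRange n)
    have h2 := hH.prop _ (List.nodup_finRange n) (by simp)
    simp at h1
    omega
  have hclosed : ∀ u v, u ≠ v → ¬ H.Adj u v → H.degree u + H.degree v < k := by
    intro u v huv hadj
    have hnot : ¬ Free (H ⊔ SimpleGraph.edge u v) := fun h =>
      hadj (hH.le_of_ge h le_sup_left (Or.inr (by simp [SimpleGraph.edge_adj, huv])))
    simp only [Free, not_forall, not_lt] at hnot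
    obtain ⟨l, hl, hm, hscore⟩ := hnot
    obtain ⟨A, C, rfl | rfl⟩ := H.exists_append_of_chainScore_sup_edge_ne u v l
      (ne_of_gt ((hH.prop l hl hm).trans_le hscore))
    · exact H.degree_add_degree_lt hH.prop hl hm hadj hscore
    · rw [SimpleGraph.edge_comm] at hscore
      rw [add_comm]
      exact H.degree_add_degree_lt hH.prop hl hm (fun h => hadj h.symm) hscore
  obtain ⟨s, hs, hbound⟩ := H.exists_two_mul_card_edgeFinset_le (by simp; omega) hne hclosed
  rw [Fintype.card_fin] at hbound
  refine le_trans ?_ (le_max_choose_of_two_mul_le (by omega) hs hbound)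
  rw [← Set.ncard_coe_finset, SimpleGraph.coe_edgeFinset]
  exact Set.ncard_le_ncard (SimpleGraph.edgeSet_mono hGH)
end

section
/- Let G be a graph that contains a linear forest F with k−1 edges, where isolated vertices are regarded as paths of length zero. If u and v are vertices that are endpoints of two different paths of F and d_G(u) + d_G(v) ≥ k, then G contains a linear forest with k edges. -/
open SimpleGraph

theorem SimpleGraph.Reachable.of_sup_edge {V : Type*} {H : SimpleGraph V} {a b c d : V}
    (h : (H ⊔ edge a b).Reachable c d) :
    H.Reachable c d ∨ (H.Reachable c a ∧ H.Reachable b d) ∨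
      (H.Reachable c b ∧ H.Reachable a d) := by
  obtain ⟨p⟩ := h
  induction p with
  | nil => exact .inl .rfl
  | cons hadj _ ih =>
    rw [sup_adj, edge_adj] at hadj
    rcases hadj with hadj | ⟨⟨rfl, rfl⟩ | ⟨rfl, rfl⟩, -⟩
    · have := hadj.reachable
      rcases ih with h | ⟨h, h'⟩ | ⟨h, h'⟩
      · exact .inl (this.trans h)
      · exact .inr (.inl ⟨this.trans h, h'⟩)
      · exact .inr (.inr ⟨this.trans h, h'⟩)
    · rcases ih with h | ⟨h, h'⟩ | ⟨h, h'⟩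
      · exact .inr (.inl ⟨.rfl, h⟩)
      · exact .inr (.inl ⟨.rfl, h'⟩)
      · exact .inl h'
    · rcases ih with h | ⟨h, h'⟩ | ⟨h, h'⟩
      · exact .inr (.inr ⟨.rfl, h⟩)
      · exact .inl h'
      · exact .inr (.inr ⟨.rfl, h'⟩)

theorem SimpleGraph.ncard_neighborSet_sup_edge_le {V : Type*} [Finite V] (H : SimpleGraph V)
    (a b c : V) : ((H ⊔ edge a b).neighborSet c).ncard ≤ (H.neighborSet c).ncard + 1 := by
  have h : ∃ d, (H ⊔ edge a b).neighborSet c ⊆ insert d (H.neighborSet c) := by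
    by_cases hc : c = a
    · refine ⟨b, fun x hx ↦ ?_⟩
      simp only [mem_neighborSet, sup_adj, edge_adj, Set.mem_insert_iff] at hx ⊢
      grind
    · refine ⟨a, fun x hx ↦ ?_⟩
      simp only [mem_neighborSet, sup_adj, edge_adj, Set.mem_insert_iff] at hx ⊢
      grind
  obtain ⟨d, hd⟩ := h
  exact (Set.ncard_le_ncard hd).trans (Set.ncard_insert_le _ _)

theorem SimpleGraph.neighborSet_sup_edge_of_ne {V : Type*} (H : SimpleGraph V)
    {a b c : V} (ha : c ≠ a) (hb : c ≠ b) :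
    (H ⊔ edge a b).neighborSet c = H.neighborSet c := by
  ext x
  simp only [mem_neighborSet, sup_adj, edge_adj]
  grind

theorem SimpleGraph.ncard_edgeSet_sup_edge {V : Type*} [Finite V] {H : SimpleGraph V} {a b : V}
    (hab : ¬ H.Adj a b) (hne : a ≠ b) :
    (H ⊔ edge a b).edgeSet.ncard = H.edgeSet.ncard + 1 := by
  rw [edgeSet_sup, edgeSet_edge_of_ne hne, Set.union_singleton,
    Set.ncard_insert_of_notMem (by simpa using hab)]

theorem SimpleGraph.ncard_neighborSet_deleteEdges_add_one {V : Type*} [Finite V]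
    {F : SimpleGraph V} {x y : V} (h : F.Adj x y) :
    ((F.deleteEdges {s(x, y)}).neighborSet x).ncard + 1 = (F.neighborSet x).ncard := by
  have : (F.deleteEdges {s(x, y)}).neighborSet x = F.neighborSet x \ {y} := by
    ext z
    simp only [mem_neighborSet, deleteEdges_adj, Set.mem_singleton_iff, Set.mem_sdiff,
      Sym2.eq_iff]
    grind
  rw [this]
  exact Set.ncard_sdiff_singleton_add_one h

theorem IsLinearForest.mono {V : Type*} [Finite V] {H F : SimpleGraph V}
    (hF : IsLinearForest F) (hle : H ≤ F) : IsLinearForest H :=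
  ⟨hF.1.anti hle, fun v ↦ (Set.ncard_le_ncard fun _ h ↦ hle h).trans (hF.2 v)⟩

theorem IsLinearForest.sup_edge {V : Type*} [Finite V] {H : SimpleGraph V} {a b : V}
    (hH : IsLinearForest H) (hab : ¬ H.Reachable a b)
    (ha : (H.neighborSet a).ncard ≤ 1) (hb : (H.neighborSet b).ncard ≤ 1) :
    IsLinearForest (H ⊔ edge a b) := by
  refine ⟨hH.1.sup_edge_of_not_reachable hab, fun c ↦ ?_⟩
  have := H.ncard_neighborSet_sup_edge_le a b c
  by_cases hca : c = a
  · subst hca; omega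
  by_cases hcb : c = b
  · subst hcb; omega
  rw [H.neighborSet_sup_edge_of_ne hca hcb]
  exact hH.2 c

/-- Removing the edge `xy` separates `x` from `u` and `y` from `v`. -/
def SeparatesEnds {V : Type*} (F : SimpleGraph V) (u v x y : V) : Prop :=
  ¬ (F.deleteEdges {s(x, y)}).Reachable x u ∧ ¬ (F.deleteEdges {s(x, y)}).Reachable y v

theorem separatesEnds_swap {V : Type*} {F : SimpleGraph V} {u v x y : V} :
    SeparatesEnds F v u y x ↔ SeparatesEnds F u v x y := by
  rw [SeparatesEnds, SeparatesEnds, Sym2.eq_swap, and_comm]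

theorem IsLinearForest.exists_of_separatesEnds {V : Type*} [Finite V] {G F : SimpleGraph V}
    {u v x y : V} (hFG : F ≤ G) (hF : IsLinearForest F)
    (hu : (F.neighborSet u).ncard ≤ 1) (hv : (F.neighborSet v).ncard ≤ 1)
    (hsep : ¬ F.Reachable u v) (huv : ¬ G.Adj u v) (hxy : F.Adj x y)
    (hS : SeparatesEnds F u v x y) (hux : G.Adj u x) (hvy : G.Adj v y) :
    ∃ F' : SimpleGraph V, F' ≤ G ∧ IsLinearForest F' ∧
      F'.edgeSet.ncard = F.edgeSet.ncard + 1 := by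
  obtain ⟨h₁, h₂⟩ := hS
  set H := F.deleteEdges {s(x, y)} with hHdef
  have hle : H ≤ F := deleteEdges_le _
  have hH : IsLinearForest H := hF.mono hle
  have hcard : H.edgeSet.ncard + 1 = F.edgeSet.ncard := by
    rw [hHdef, edgeSet_deleteEdges]
    exact Set.ncard_sdiff_singleton_add_one (by simpa using hxy)
  have hHle (w : V) : (H.neighborSet w).ncard ≤ (F.neighborSet w).ncard :=
    Set.ncard_le_ncard fun _ h ↦ hle h
  have hx : (H.neighborSet x).ncard ≤ 1 := by
    have := ncard_neighborSet_deleteEdges_add_one hxy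
    rw [← hHdef] at this
    have := hF.2 x
    omega
  have hy : (H.neighborSet y).ncard ≤ 1 := by
    have := ncard_neighborSet_deleteEdges_add_one hxy.symm
    rw [Sym2.eq_swap, ← hHdef] at this
    have := hF.2 y
    omega
  have hvx : v ≠ x := by rintro rfl; exact huv hux
  have hyu : y ≠ u := by rintro rfl; exact huv hvy.symm
  have hvu : v ≠ u := by rintro rfl; exact hsep .rfl
  have hux' : ¬ H.Reachable u x := fun h ↦ h₁ h.symm
  have hH₁ := hH.sup_edge hux' ((hHle u).trans hu) hx
  have hnr : ¬ (H ⊔ edge u x).Reachable v y := by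
    intro h
    rcases h.of_sup_edge with h | ⟨h, -⟩ | ⟨h, h'⟩
    · exact h₂ h.symm
    · exact hsep (h.mono hle).symm
    · exact hsep ((h'.mono hle).trans (hxy.symm.reachable.trans (h.mono hle).symm))
  refine ⟨H ⊔ edge u x ⊔ edge v y, ?_, hH₁.sup_edge hnr ?_ ?_, ?_⟩
  · exact sup_le (sup_le (hle.trans hFG) ((edge_le_iff _).2 (.inr hux))) ((edge_le_iff _).2 (.inr hvy))
  · rw [neighborSet_sup_edge_of_ne _ hvu hvx]
    exact (hHle v).trans hv
  · rwa [neighborSet_sup_edge_of_ne _ hyu hxy.ne']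
  · rw [ncard_edgeSet_sup_edge (fun h ↦ hnr h.reachable) hvy.ne,
      ncard_edgeSet_sup_edge (fun h ↦ hux' h.reachable) hux.ne, hcard]

theorem SimpleGraph.IsAcyclic.exists_adj_toward {V : Type*} {F : SimpleGraph V}
    (hF : F.IsAcyclic) {x w : V} (hxw : F.Reachable x w) (hne : x ≠ w) :
    ∃ p, F.Adj x p ∧ ¬ (F.deleteEdges {s(x, p)}).Reachable x w ∧
      (F.deleteEdges {s(x, p)}).Reachable p w ∧
      ∀ y, F.Adj x y → y ≠ p → (F.deleteEdges {s(x, y)}).Reachable x w := by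
  obtain ⟨q, hq⟩ := hxw.exists_isPath
  cases q with
  | nil => exact absurd rfl hne
  | @cons _ p _ h q =>
    rw [Walk.cons_isPath_iff] at hq
    have hnot (z : V) : s(x, z) ∉ q.edges := fun hz ↦ hq.2 (q.fst_mem_support_of_mem_edges hz)
    have hpw : (F.deleteEdges {s(x, p)}).Reachable p w :=
      ⟨q.toDeleteEdges _ fun e he hep ↦ hnot p (by rwa [← Set.mem_singleton_iff.1 hep])⟩
    refine ⟨p, h, fun hx ↦ ?_, hpw, fun y _ hyp ↦ ?_⟩
    · exact isAcyclic_iff_forall_adj_isBridge.1 hF h (hx.trans hpw.symm)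
    · refine ⟨(Walk.cons h q).toDeleteEdges _ fun e he hey ↦ ?_⟩
      rw [Set.mem_singleton_iff.1 hey, Walk.edges_cons, List.mem_cons] at he
      rcases he with he | he
      · rw [Sym2.eq_iff] at he
        grind
      · exact hnot y he

theorem SimpleGraph.IsAcyclic.exists_separatesEnds {V : Type*} {F : SimpleGraph V}
    (hF : F.IsAcyclic) {u v x : V} (hsep : ¬ F.Reachable u v) (hxu : x ≠ u) (hxv : x ≠ v)
    (hx : ¬ F.Reachable x u → ∃ y z, F.Adj x y ∧ F.Adj x z ∧ y ≠ z) :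
    (∃ y, F.Adj x y ∧ SeparatesEnds F u v x y ∧ ¬ SeparatesEnds F u v y x) ∨
      ∃ y z, y ≠ z ∧ (F.Adj x y ∧ SeparatesEnds F u v x y) ∧
        (F.Adj x z ∧ SeparatesEnds F u v x z) := by
  by_cases hu : F.Reachable x u
  · obtain ⟨p, hp, h₁, h₂, -⟩ := hF.exists_adj_toward hu hxu
    refine .inl ⟨p, hp, ⟨h₁, fun h ↦ ?_⟩, fun h ↦ h.1 ?_⟩
    · exact hsep (hu.symm.trans (hp.reachable.trans (h.mono (deleteEdges_le _))))
    · rwa [Sym2.eq_swap]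
  obtain ⟨y, z, hy, hz, hyz⟩ := hx hu
  by_cases hv : F.Reachable x v
  · obtain ⟨p, -, -, -, h⟩ := hF.exists_adj_toward hv hxv
    obtain ⟨y, hy, hyp⟩ : ∃ y, F.Adj x y ∧ y ≠ p := by
      by_cases hyp : y = p
      · exact ⟨z, hz, hyp ▸ hyz.symm⟩
      · exact ⟨y, hy, hyp⟩
    have hr := h y hy hyp
    refine .inl ⟨y, hy, ⟨fun h ↦ hu (h.mono (deleteEdges_le _)), fun h ↦ ?_⟩, fun h ↦ h.2 ?_⟩
    · exact isAcyclic_iff_forall_adj_isBridge.1 hF hy (hr.trans h.symm)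
    · rwa [Sym2.eq_swap]
  · have key (y : V) (hy : F.Adj x y) : SeparatesEnds F u v x y :=
      ⟨fun h ↦ hu (h.mono (deleteEdges_le _)),
        fun h ↦ hv (hy.reachable.trans (h.mono (deleteEdges_le _)))⟩
    exact .inr ⟨y, z, hyz, ⟨hy, key y hy⟩, hz, key z hz⟩

open scoped Classical in
/-- The weight of the dart `(x, y)` of `F`; the two orientations of an edge together have weight
at most `2`. -/
noncomputable def dartWeight {V : Type*} (F : SimpleGraph V) (u v x y : V) : ℕ :=
  if F.Adj x y ∧ SeparatesEnds F u v x y then if SeparatesEnds F u v y x then 1 else 2 else 0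

open scoped Classical in
theorem dartWeight_swap {V : Type*} (F : SimpleGraph V) (u v x y : V) :
    dartWeight F v u y x = dartWeight F u v x y := by
  refine if_congr ?_ (if_congr separatesEnds_swap rfl rfl) rfl
  rw [F.adj_comm, separatesEnds_swap]

open scoped Classical in
theorem sum_dartWeight_le {V : Type*} [Fintype V] (F : SimpleGraph V) (u v : V) :
    ∑ x, ∑ y, dartWeight F u v x y ≤ 2 * F.edgeSet.ncard := by
  have hE : ∑ x, ∑ y, (if F.Adj x y then 1 else 0) = 2 * F.edgeSet.ncard := by
    rw [Set.ncard_eq_toFinset_card', ← edgeFinset, ← sum_degrees_eq_twice_card_edges]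
    refine Finset.sum_congr rfl fun x _ ↦ ?_
    rw [← Finset.card_filter, ← card_neighborFinset_eq_degree, neighborFinset_eq_filter]
  have h : ∑ x, ∑ y, (dartWeight F u v x y + dartWeight F u v y x) ≤
      ∑ x, ∑ y, 2 * (if F.Adj x y then 1 else 0) := by
    gcongr with x _ y _
    simp only [dartWeight, F.adj_comm y x]
    grind
  simp only [Finset.sum_add_distrib, ← Finset.mul_sum] at h
  rw [Finset.sum_comm (f := fun x y ↦ dartWeight F u v y x), hE] at h
  omega

theorem SimpleGraph.IsAcyclic.two_le_sum_dartWeight {V : Type*} [Fintype V] {F : SimpleGraph V}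
    (hF : F.IsAcyclic) {u v x : V} (hsep : ¬ F.Reachable u v) (hxu : x ≠ u) (hxv : x ≠ v)
    (hx : ¬ F.Reachable x u → ∃ y z, F.Adj x y ∧ F.Adj x z ∧ y ≠ z) :
    2 ≤ ∑ y, dartWeight F u v x y := by
  classical
  rcases hF.exists_separatesEnds hsep hxu hxv hx with ⟨y, hy, h, h'⟩ | ⟨y, z, hyz, hy, hz⟩
  · calc 2 = dartWeight F u v x y := by simp [dartWeight, hy, h, h']
      _ ≤ _ := Finset.single_le_sum (f := dartWeight F u v x) (fun _ _ ↦ Nat.zero_le _)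
        (Finset.mem_univ y)
  · have h (w : V) (hw : F.Adj x w ∧ SeparatesEnds F u v x w) : 1 ≤ dartWeight F u v x w := by
      rw [dartWeight, if_pos hw]
      split_ifs <;> omega
    calc 2 ≤ dartWeight F u v x y + dartWeight F u v x z := Nat.add_le_add (h y hy) (h z hz)
      _ = ∑ w ∈ {y, z}, dartWeight F u v x w := (Finset.sum_pair hyz).symm
      _ ≤ _ := Finset.sum_le_sum_of_subset (Finset.subset_univ _)

open scoped Classical in
theorem SimpleGraph.IsAcyclic.two_mul_ncard_neighborSet_le {V : Type*} [Fintype V]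
    {G F : SimpleGraph V} (hF : F.IsAcyclic) {u v : V} (hsep : ¬ F.Reachable u v)
    (huv : ¬ G.Adj u v)
    (h : ∀ x, G.Adj u x → ¬ F.Reachable x u → ∃ y z, F.Adj x y ∧ F.Adj x z ∧ y ≠ z) :
    2 * (G.neighborSet u).ncard ≤
      ∑ x, ∑ y, if G.Adj u x then dartWeight F u v x y else 0 := by
  rw [Set.ncard_eq_toFinset_card', ← neighborFinset, neighborFinset_eq_filter, Finset.card_filter,
    Finset.mul_sum]
  refine Finset.sum_le_sum fun x _ ↦ ?_
  split_ifs with hx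
  · exact hF.two_le_sum_dartWeight hsep hx.ne' (by rintro rfl; exact huv hx) (h x hx)
  · simp

theorem IsLinearForest.exists_ncard_edgeSet_eq_add_one {V : Type*} [Fintype V]
    {G F : SimpleGraph V} {u v : V} (hFG : F ≤ G) (hF : IsLinearForest F)
    (hu : (F.neighborSet u).ncard ≤ 1) (hv : (F.neighborSet v).ncard ≤ 1)
    (hsep : ¬ F.Reachable u v)
    (hdeg : F.edgeSet.ncard < (G.neighborSet u).ncard + (G.neighborSet v).ncard) :
    ∃ F' : SimpleGraph V, F' ≤ G ∧ IsLinearForest F' ∧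
      F'.edgeSet.ncard = F.edgeSet.ncard + 1 := by
  classical
  by_contra hno
  have hadd {a b : V} (hab : G.Adj a b) (ha : (F.neighborSet a).ncard ≤ 1)
      (hb : (F.neighborSet b).ncard ≤ 1) : F.Reachable b a := by
    by_contra hr
    have hr' : ¬ F.Reachable a b := fun h ↦ hr h.symm
    exact hno ⟨F ⊔ edge a b, sup_le hFG ((edge_le_iff _).2 (.inr hab)), hF.sup_edge hr' ha hb,
      ncard_edgeSet_sup_edge (fun h ↦ hr' h.reachable) hab.ne⟩
  have huv : ¬ G.Adj u v := fun h ↦ hsep (hadd h hu hv).symm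
  have htwo (w : V) (hw : (F.neighborSet w).ncard ≤ 1) (x : V) (hwx : G.Adj w x)
      (hr : ¬ F.Reachable x w) : ∃ y z, F.Adj x y ∧ F.Adj x z ∧ y ≠ z := by
    have : 1 < (F.neighborSet x).ncard := by
      by_contra! hx
      exact hr (hadd hwx hw hx)
    obtain ⟨y, hy, z, hz, hyz⟩ := (Set.one_lt_ncard (Set.toFinite _)).1 this
    exact ⟨y, z, hy, hz, hyz⟩
  have h₁ := hF.1.two_mul_ncard_neighborSet_le hsep huv (htwo u hu)
  have h₂ := hF.1.two_mul_ncard_neighborSet_le (fun h ↦ hsep h.symm) (fun h ↦ huv h.symm)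
    (htwo v hv)
  rw [Finset.sum_comm] at h₂
  simp only [dartWeight_swap] at h₂
  have h₃ : ∑ x, ∑ y, ((if G.Adj u x then dartWeight F u v x y else 0) +
      if G.Adj v y then dartWeight F u v x y else 0) ≤ ∑ x, ∑ y, dartWeight F u v x y := by
    gcongr with x _ y _
    by_cases hw : F.Adj x y ∧ SeparatesEnds F u v x y
    · have : ¬ (G.Adj u x ∧ G.Adj v y) := fun h ↦
        hno (hF.exists_of_separatesEnds hFG hu hv hsep huv hw.1 hw.2 h.1 h.2)
      grind
    · simp [dartWeight, hw]
  simp only [Finset.sum_add_distrib] at h₃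
  have h₄ := sum_dartWeight_le F u v
  omega

theorem stmt_5 {V : Type*} [Fintype V] (G F : SimpleGraph V) (k : ℕ) (hk : 1 ≤ k) (u v : V)
    (hFG : F ≤ G) (hF : IsLinearForest F) (hFcard : F.edgeSet.ncard = k - 1)
    (hu : (F.neighborSet u).ncard ≤ 1) (hv : (F.neighborSet v).ncard ≤ 1)
    (hsep : ¬ F.Reachable u v)
    (hdeg : k ≤ (G.neighborSet u).ncard + (G.neighborSet v).ncard) :
    ∃ F' : SimpleGraph V, F' ≤ G ∧ IsLinearForest F' ∧ F'.edgeSet.ncard = k := by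
  obtain ⟨F', hle, hF', hcard⟩ :=
    hF.exists_ncard_edgeSet_eq_add_one hFG hu hv hsep (by omega)
  exact ⟨F', hle, hF', by omega⟩
end

section
/- For all integers n and k with 2 ≤ k ≤ n−1, the maximum number of edges in a graph G on n vertices whose Hamiltonian completion number satisfies h(G) ≥ k equals max{ C(n−k+1, 2), C(n,2) − C(n−⌊(n−k)/2⌋, 2) + c }, where c = 0 if n−k+1 is odd and c = 1 if n−k+1 is even. -/
/-- The Hamiltonian completion number of `G`: the minimum number of edges one has to
add to `G` in order to obtain a graph containing a Hamiltonian cycle. -/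
noncomputable def hamCompletion {V : Type*} [Fintype V] [DecidableEq V]
    (G : SimpleGraph V) : ℕ :=
  sInf {m : ℕ | ∃ H : SimpleGraph V, G ≤ H ∧ H.IsHamiltonian ∧
    (H.edgeSet \ G.edgeSet).ncard = m}

open Finset SimpleGraph

/-- The number of edges of `G` used by the closed cyclic ordering `f` of vertices. -/
noncomputable def cyclicHits {V : Type*} {N : ℕ} (G : SimpleGraph V) (f : Fin (N + 3) → V) : ℕ :=
  haveI := Classical.decPred fun i => G.Adj (f i) (f (i + 1))
  ∑ i, if G.Adj (f i) (f (i + 1)) then 1 else 0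

theorem isHamiltonian_iff_exists_cyclic {V : Type*} [Fintype V] [DecidableEq V] {N : ℕ}
    (hV : Fintype.card V = N + 3) (H : SimpleGraph V) :
    H.IsHamiltonian ↔
      ∃ f : Fin (N + 3) → V, f.Injective ∧ ∀ i, H.Adj (f i) (f (i + 1)) := by
  have h1 : H.IsHamiltonian ↔ cycleGraph (N + 3) ⊑ H := by
    rw [cycleGraph_isContained_iff (by omega), IsHamiltonian]
    simp only [Walk.isHamiltonianCycle_iff_isCycle_and_length_eq, hV]
    exact ⟨fun h => h (by omega), fun h _ => h⟩
  rw [h1]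
  constructor
  · rintro ⟨φ⟩
    refine ⟨φ, φ.injective, fun i => φ.toHom.map_adj ?_⟩
    rw [cycleGraph_adj]
    right
    simp
  · rintro ⟨f, hf, h⟩
    refine ⟨⟨⟨f, ?_⟩, hf⟩⟩
    intro a b hab
    rw [cycleGraph_adj] at hab
    rcases hab with hab | hab
    · rw [sub_eq_iff_eq_add'.1 hab, add_comm]
      rw [add_comm]
      exact (h b).symm
    · rw [sub_eq_iff_eq_add'.1 hab]
      exact h a

theorem cyclic_edge_injective {V : Type*} {N : ℕ} {f : Fin (N + 3) → V} (hf : f.Injective) :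
    Function.Injective fun i => s(f i, f (i + 1)) := by
  intro i j hij
  simp only [Sym2.eq_iff] at hij
  rcases hij with ⟨h, -⟩ | ⟨h1, h2⟩
  · exact hf h
  · have h1 := hf h1
    have h2 := hf h2
    subst h1
    rw [add_assoc, add_eq_left] at h2
    exfalso
    have := congrArg Fin.val h2
    simp [Fin.val_add, Nat.mod_eq_of_lt] at this

theorem cyclicHits_eq_card {V : Type*} {N : ℕ} (G : SimpleGraph V) (f : Fin (N + 3) → V)
    [DecidablePred fun i => G.Adj (f i) (f (i + 1))] :
    cyclicHits G f = #{i | G.Adj (f i) (f (i + 1))} := by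
  rw [cyclicHits, card_filter]
  congr!

theorem le_hamCompletion_iff {V : Type*} [Fintype V] [DecidableEq V] {N k : ℕ}
    (hV : Fintype.card V = N + 3) (G : SimpleGraph V) :
    k ≤ hamCompletion G ↔
      ∀ f : Fin (N + 3) → V, f.Injective → k + cyclicHits G f ≤ N + 3 := by
  classical
  have hcount (f : Fin (N + 3) → V) :
      #{i | ¬ G.Adj (f i) (f (i + 1))} + cyclicHits G f = N + 3 := by
    rw [cyclicHits_eq_card, add_comm, card_filter_add_card_filter_not]
    simp
  constructor
  · intro hk f hf
    let C : SimpleGraph V := fromEdgeSet (Set.range fun i => s(f i, f (i + 1)))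
    have hH : (G ⊔ C).IsHamiltonian := by
      rw [isHamiltonian_iff_exists_cyclic hV]
      refine ⟨f, hf, fun i => Or.inr ?_⟩
      rw [fromEdgeSet_adj]
      refine ⟨⟨i, rfl⟩, fun h => ?_⟩
      have := hf h
      simp at this
    have h1 : hamCompletion G ≤ ((G ⊔ C).edgeSet \ G.edgeSet).ncard :=
      Nat.sInf_le ⟨G ⊔ C, le_sup_left, hH, rfl⟩
    have h2 : (G ⊔ C).edgeSet \ G.edgeSet ⊆
        ((({i | ¬ G.Adj (f i) (f (i + 1))} : Finset (Fin (N + 3))).image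
          fun i => s(f i, f (i + 1)) : Finset (Sym2 V)) : Set (Sym2 V)) := by
      intro e he
      rw [edgeSet_sup, edgeSet_fromEdgeSet] at he
      obtain ⟨he | ⟨⟨i, rfl⟩, -⟩, hne⟩ := he
      · exact absurd he hne
      · simp only [coe_image, Set.mem_image]
        exact ⟨i, by simpa using hne, rfl⟩
    have h3 := Set.ncard_le_ncard h2 (Finset.finite_toSet _)
    rw [Set.ncard_coe_finset] at h3
    have h4 := h3.trans card_image_le
    have := hcount f
    omega
  · intro h
    refine le_csInf ?_ ?_
    · refine ⟨_, ⊤, le_top, ?_, rfl⟩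
      rw [isHamiltonian_iff_exists_cyclic hV]
      let e := (Fintype.equivFinOfCardEq hV).symm
      refine ⟨e, e.injective, fun i => ?_⟩
      rw [top_adj, Ne, e.injective.eq_iff]
      simp
    · rintro _ ⟨H, hGH, hH, rfl⟩
      obtain ⟨f, hf, hadj⟩ := (isHamiltonian_iff_exists_cyclic hV H).1 hH
      have h2 : ((({i | ¬ G.Adj (f i) (f (i + 1))} : Finset (Fin (N + 3))).image
          fun i => s(f i, f (i + 1)) : Finset (Sym2 V)) : Set (Sym2 V)) ⊆
          H.edgeSet \ G.edgeSet := by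
        intro e he
        simp only [coe_image, Set.mem_image] at he
        obtain ⟨i, hi, rfl⟩ := he
        exact ⟨hadj i, by simpa using hi⟩
      have h3 := Set.ncard_le_ncard h2 (Set.toFinite _)
      rw [Set.ncard_coe_finset, card_image_of_injective _ (cyclic_edge_injective hf)] at h3
      have := hcount f
      have := h f hf
      omega

theorem cyclicHits_rotate {V : Type*} {N : ℕ} (G : SimpleGraph V) (f : Fin (N + 3) → V)
    (c : Fin (N + 3)) : cyclicHits G (fun i => f (i + c)) = cyclicHits G f := by
  classical
  unfold cyclicHits
  refine Fintype.sum_equiv (Equiv.addRight c) _ _ fun i => ?_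
  simp only [Equiv.coe_addRight, add_right_comm]
  congr!

theorem cyclicHits_eq_sum_range {V : Type*} {N : ℕ} (G : SimpleGraph V)
    [DecidableRel G.Adj] (g : ℕ → V) :
    cyclicHits G (fun i : Fin (N + 3) => g i) =
      (∑ j ∈ range (N + 2), if G.Adj (g j) (g (j + 1)) then 1 else 0) +
        if G.Adj (g (N + 2)) (g 0) then 1 else 0 := by
  rw [cyclicHits, Fin.sum_univ_castSucc, sum_range]
  simp only [Fin.coeSucc_eq_succ, Fin.last_add_one, Fin.val_castSucc, Fin.val_succ, Fin.val_last,
    Fin.val_zero]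

/-- Reversing the tail of a cyclic ordering after position `i`. -/
theorem exists_cyclicHits_reverse_tail {V : Type*} {N : ℕ} (G : SimpleGraph V)
    [DecidableRel G.Adj] {g : ℕ → V}
    (hg : Set.InjOn g (Set.Iic (N + 2))) {i : ℕ} (hi : i < N + 2) :
    ∃ f : Fin (N + 3) → V, f.Injective ∧
      cyclicHits G f + (if G.Adj (g i) (g (i + 1)) then 1 else 0) =
        (∑ j ∈ range (N + 2), if G.Adj (g j) (g (j + 1)) then 1 else 0) +
          (if G.Adj (g i) (g (N + 2)) then 1 else 0) +
          (if G.Adj (g (i + 1)) (g 0) then 1 else 0) := by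
  set g' : ℕ → V := fun j => g (if j ≤ i then j else N + 3 + i - j) with hg'
  refine ⟨fun j => g' j, ?_, ?_⟩
  · intro a b hab
    have ha := a.2
    have hb := b.2
    have := hg (by simp only [Set.mem_Iic]; split_ifs <;> omega)
      (by simp only [Set.mem_Iic]; split_ifs <;> omega) hab
    ext
    split_ifs at this <;> omega
  · rw [cyclicHits_eq_sum_range]
    obtain ⟨r, hr⟩ : ∃ r, N + 2 = i + 1 + r := ⟨N + 1 - i, by omega⟩
    rw [hr, sum_range_add _ (i + 1) r, sum_range_add _ (i + 1) r, sum_range_succ _ i,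
      sum_range_succ _ i]
    have h1 : ∀ j ∈ range i, (if G.Adj (g' j) (g' (j + 1)) then 1 else 0) =
        if G.Adj (g j) (g (j + 1)) then 1 else 0 := by
      intro j hj
      rw [mem_range] at hj
      simp only [hg', if_pos hj.le, if_pos (show j + 1 ≤ i by omega)]
    have h2 : ∑ j ∈ range r, (if G.Adj (g' (i + 1 + j)) (g' (i + 1 + j + 1)) then 1 else 0) =
        ∑ j ∈ range r, if G.Adj (g (i + 1 + j)) (g (i + 1 + j + 1)) then 1 else 0 := by
      rw [← sum_range_reflect]
      refine sum_congr rfl fun j hj => ?_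
      rw [mem_range] at hj
      simp only [hg', if_neg (show ¬ i + 1 + (r - 1 - j) ≤ i by omega),
        if_neg (show ¬ i + 1 + (r - 1 - j) + 1 ≤ i by omega)]
      simp only [G.adj_comm (g (N + 3 + i - (i + 1 + (r - 1 - j))))]
      rw [show N + 3 + i - (i + 1 + (r - 1 - j) + 1) = i + 1 + j by omega,
        show N + 3 + i - (i + 1 + (r - 1 - j)) = i + 1 + j + 1 by omega]
    have h3 : g' i = g i := by simp [hg']
    have h4 : g' (i + 1) = g (i + 1 + r) := by
      simp only [hg', if_neg (show ¬ i + 1 ≤ i by omega)]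
      congr 1
      omega
    have h5 : g' (i + 1 + r) = g (i + 1) := by
      simp only [hg', if_neg (show ¬ i + 1 + r ≤ i by omega)]
      congr 1
      omega
    have h6 : g' 0 = g 0 := by simp [hg']
    rw [sum_congr rfl h1, h2, h3, h4, h5, h6]
    ring

theorem degree_eq_sum_ite {V ι : Type*} [Fintype V] (G : SimpleGraph V) [DecidableRel G.Adj]
    (s : Finset ι) (g : ι → V) (hg : Set.InjOn g s) (u : V)
    (hu : ∀ w, G.Adj u w → ∃ j ∈ s, g j = w) :
    G.degree u = ∑ j ∈ s, if G.Adj u (g j) then 1 else 0 := by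
  classical
  rw [← card_filter, ← card_neighborFinset_eq_degree]
  symm
  refine card_bij (fun j _ => g j) ?_ ?_ ?_
  · simp
  · intro a ha b hb hab
    simp only [mem_filter] at ha hb
    exact hg ha.1 hb.1 hab
  · intro w hw
    rw [mem_neighborFinset] at hw
    obtain ⟨j, hj, rfl⟩ := hu w hw
    exact ⟨j, by simp [hj, hw], rfl⟩

open Fin.NatCast in
/-- An Ore-type degree condition: if the non-edge `uv` is critical for having a cyclic ordering
with more than `m` edges, then the degrees of `u` and `v` sum to at most `m`. -/
theorem degree_add_degree_le_of_critical {V : Type*} [Fintype V] {N m : ℕ}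
    (hV : Fintype.card V = N + 3) (G : SimpleGraph V) [DecidableRel G.Adj]
    (hG : ∀ f : Fin (N + 3) → V, f.Injective → cyclicHits G f ≤ m)
    {u v : V} (huv : ¬ G.Adj u v)
    (h : ∃ f : Fin (N + 3) → V, f.Injective ∧ m < cyclicHits (G ⊔ edge u v) f) :
    G.degree u + G.degree v ≤ m := by
  classical
  obtain ⟨f, hf, hlt⟩ := h
  obtain ⟨c, hc⟩ : ∃ c, (G ⊔ edge u v).Adj (f c) (f (c + 1)) ∧ ¬ G.Adj (f c) (f (c + 1)) := by
    by_contra! hcon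
    have : cyclicHits (G ⊔ edge u v) f ≤ cyclicHits G f := by
      rw [cyclicHits_eq_card, cyclicHits_eq_card]
      exact card_le_card fun i hi => by
        simp only [mem_filter, mem_univ, true_and] at hi ⊢
        exact hcon i hi
    have := hG f hf
    omega
  have hc' := hc.1.resolve_left hc.2
  rw [edge_adj] at hc'
  wlog hor : f c = v ∧ f (c + 1) = u generalizing u v
  · rw [add_comm]
    refine this (u := v) (v := u) (fun h => huv h.symm) ?_ ?_ ?_ ?_
    · rwa [edge_comm]
    · rwa [edge_comm]
    · tauto
    · tauto
  obtain ⟨hcv, hcu⟩ := hor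
  set g : ℕ → V := fun j => f ((j : Fin (N + 3)) + (c + 1)) with hgdef
  have hginj : Set.InjOn g (Set.Iic (N + 2)) := by
    intro a ha b hb hab
    have := add_right_cancel (hf hab)
    have := congrArg Fin.val this
    simp only [Set.mem_Iic] at ha hb
    rwa [Fin.val_cast_of_lt (by omega), Fin.val_cast_of_lt (by omega)] at this
  have hgsurj : ∀ w, ∃ j, j ≤ N + 2 ∧ g j = w := by
    intro w
    have hbij : f.Bijective := (Fintype.bijective_iff_injective_and_card f).2 ⟨hf, by simp [hV]⟩
    obtain ⟨i, rfl⟩ := hbij.2 w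
    refine ⟨(i - (c + 1) : Fin (N + 3)), by omega, ?_⟩
    simp [hgdef]
  have hrot (K : SimpleGraph V) : cyclicHits K (fun i : Fin (N + 3) => g i) = cyclicHits K f := by
    rw [← cyclicHits_rotate K f (c + 1)]
    simp [hgdef]
  have hg0 : g 0 = u := by simp [hgdef, hcu]
  have hgl : g (N + 2) = v := by
    rw [← hcv]
    simp only [hgdef]
    congr 1
    have : ((N + 2 : ℕ) : Fin (N + 3)) = Fin.last (N + 2) := Fin.natCast_eq_last _
    rw [this, add_comm c, ← add_assoc, Fin.last_add_one, zero_add]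
  set w := ∑ j ∈ range (N + 2), if G.Adj (g j) (g (j + 1)) then 1 else 0 with hw
  have hwle : w ≤ m := by
    have := hG _ hf
    rw [← hrot, cyclicHits_eq_sum_range] at this
    omega
  have hwge : m ≤ w := by
    rw [← hrot, cyclicHits_eq_sum_range] at hlt
    have h1 : ∀ j ∈ range (N + 2),
        (if (G ⊔ edge u v).Adj (g j) (g (j + 1)) then 1 else 0) =
          if G.Adj (g j) (g (j + 1)) then 1 else 0 := by
      intro j hj
      rw [mem_range] at hj
      have : ¬ (edge u v).Adj (g j) (g (j + 1)) := by
        rw [edge_adj, ← hg0, ← hgl]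
        have e (a b : ℕ) (ha : a ≤ N + 2) (hb : b ≤ N + 2) : g a = g b ↔ a = b :=
          hginj.eq_iff ha hb
        rw [e _ _ (by omega) (by omega), e _ _ (by omega) (by omega),
          e _ _ (by omega) (by omega), e _ _ (by omega) (by omega)]
        omega
      simp only [sup_adj, this, or_false]
    rw [sum_congr rfl h1] at hlt
    split_ifs at hlt <;> omega
  have hkey : ∀ i ∈ range (N + 2), (if G.Adj u (g (i + 1)) then 1 else 0) +
      (if G.Adj v (g i) then 1 else 0) ≤ if G.Adj (g i) (g (i + 1)) then 1 else 0 := by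
    intro i hi
    obtain ⟨f', hf', hh⟩ := exists_cyclicHits_reverse_tail G hginj (mem_range.1 hi)
    have := hG f' hf'
    rw [hg0, hgl, ← hw] at hh
    simp only [G.adj_comm (g i) v, G.adj_comm (g (i + 1)) u] at hh
    omega
  have hdu := degree_eq_sum_ite G (range (N + 2)) (fun j => g (j + 1)) (by
    intro a ha b hb hab
    simp only [coe_range, Set.mem_Iio] at ha hb
    have := hginj (by simp only [Set.mem_Iic]; omega) (by simp only [Set.mem_Iic]; omega) hab
    omega) u (by
    intro x hx
    obtain ⟨j, hj, rfl⟩ := hgsurj x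
    rcases j with _ | j
    · rw [hg0] at hx
      exact (G.irrefl hx).elim
    · exact ⟨j, mem_range.2 (by omega), rfl⟩)
  have hdv := degree_eq_sum_ite G (range (N + 2)) g (hginj.mono (by
    intro a ha
    simp only [coe_range, Set.mem_Iio, Set.mem_Iic] at ha ⊢
    omega)) v (by
    intro x hx
    obtain ⟨j, hj, rfl⟩ := hgsurj x
    refine ⟨j, mem_range.2 (lt_of_le_of_ne hj ?_), rfl⟩
    rintro rfl
    rw [hgl] at hx
    exact G.irrefl hx)
  rw [hdu, hdv, ← sum_add_distrib]
  exact (sum_le_sum hkey).trans hwle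

theorem ncard_edgeSet_le_of_degree_le {V : Type*} [Fintype V] [DecidableEq V] (G : SimpleGraph V)
    [DecidableRel G.Adj] (S : Finset V) (j : ℕ) (hS : ∀ v ∈ S, G.degree v ≤ j) :
    G.edgeSet.ncard ≤ (Fintype.card V - #S).choose 2 + #S * j := by
  have hsub : G.edgeFinset ⊆ (Sᶜ.offDiag.image Sym2.mk.uncurry) ∪
      S.biUnion fun v => G.incidenceFinset v := by
    intro e
    induction e with | h a b
    intro he
    rw [mem_edgeFinset, mem_edgeSet] at he
    simp only [mem_union, mem_image, mem_biUnion]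
    by_cases ha : a ∈ S
    · exact Or.inr ⟨a, ha, by simp [he]⟩
    by_cases hb : b ∈ S
    · exact Or.inr ⟨b, hb, by simp [mk'_mem_incidenceSet_iff, he]⟩
    exact Or.inl ⟨(a, b), by simp [ha, hb, he.ne], rfl⟩
  rw [← coe_edgeFinset, Set.ncard_coe_finset]
  refine (card_le_card hsub).trans ((card_union_le _ _).trans (add_le_add ?_ ?_))
  · rw [← card_compl]
    exact (Sym2.card_image_offDiag _).le
  · exact card_biUnion_le_card_mul _ _ _ fun v hv => by
      rw [card_incidenceFinset_eq_degree]; exact hS v hv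

theorem cyclicHits_le_card {V : Type*} {N : ℕ} (G : SimpleGraph V) {f : Fin (N + 3) → V}
    (hf : f.Injective) [Finite V] : cyclicHits G f ≤ G.edgeSet.ncard := by
  classical
  rw [cyclicHits_eq_card, ← card_image_of_injective _ (cyclic_edge_injective hf),
    ← Set.ncard_coe_finset]
  refine Set.ncard_le_ncard ?_ (Set.toFinite _)
  intro e he
  simp only [coe_image, Set.mem_image] at he
  obtain ⟨i, hi, rfl⟩ := he
  simpa using hi

/-- A Pósa-type edge bound in terms of a degree parameter `j`. -/
theorem exists_ncard_edgeSet_le {V : Type*} [Fintype V] [DecidableEq V] {N m : ℕ}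
    (hV : Fintype.card V = N + 3) (hm : m < N + 3) (G : SimpleGraph V)
    (hG : ∀ f : Fin (N + 3) → V, f.Injective → cyclicHits G f ≤ m) :
    ∃ j, 2 * j ≤ m ∧
      G.edgeSet.ncard ≤ (m + 1 - j).choose 2 + (N + 2 - m + j) * j := by
  classical
  obtain ⟨K, hGK, hK⟩ := (Set.toFinite {K : SimpleGraph V |
    ∀ f : Fin (N + 3) → V, f.Injective → cyclicHits K f ≤ m}).exists_le_maximal hG
  have hne : ({p | p.1 ≠ p.2 ∧ ¬ K.Adj p.1 p.2} : Finset (V × V)).Nonempty := by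
    by_contra hcon
    rw [not_nonempty_iff_eq_empty, filter_eq_empty_iff] at hcon
    let e := (Fintype.equivFinOfCardEq hV).symm
    have h1 := hK.prop e e.injective
    rw [cyclicHits_eq_card, filter_true_of_mem] at h1
    · simp at h1
      omega
    · intro i _
      have := hcon (mem_univ (e i, e (i + 1)))
      by_contra h
      exact this ⟨by simp [e.injective.eq_iff], h⟩
  obtain ⟨⟨u, v⟩, huv, hmax⟩ := exists_max_image _ (fun p => K.degree p.1 + K.degree p.2) hne
  simp only [mem_filter, mem_univ, true_and, Prod.forall] at huv hmax
  wlog hle : K.degree u ≤ K.degree v generalizing u v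
  · refine this v u ⟨huv.1.symm, fun h => huv.2 h.symm⟩ ?_ (by omega)
    intro a b hab
    have := hmax a b hab
    omega
  have hsum : K.degree u + K.degree v ≤ m := by
    refine degree_add_degree_le_of_critical hV K hK.prop huv.2 ?_
    by_contra! hcon
    have := hK.le_of_ge (y := K ⊔ edge u v) hcon le_sup_left
    exact huv.2 (this (Or.inr (by simp [edge_adj, huv.1])))
  refine ⟨K.degree u, by omega, ?_⟩
  have hcard : N + 2 - m + K.degree u ≤ #((K.neighborFinset v ∪ {v})ᶜ) := by
    have h1 := card_union_le (K.neighborFinset v) {v}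
    rw [card_neighborFinset_eq_degree, card_singleton] at h1
    rw [card_compl, hV]
    omega
  obtain ⟨S, hS, hScard⟩ := exists_subset_card_eq hcard
  have h2 := ncard_edgeSet_le_of_degree_le K S (K.degree u) (by
    intro w hw
    have := hS hw
    simp only [mem_compl, mem_union, mem_neighborFinset, mem_singleton, not_or] at this
    have := hmax w v ⟨this.2, fun h => this.1 h.symm⟩
    omega)
  have h3 : G.edgeSet.ncard ≤ K.edgeSet.ncard :=
    Set.ncard_le_ncard (edgeSet_mono hGK) (Set.toFinite _)
  rw [hScard, hV, show N + 3 - (N + 2 - m + K.degree u) = m + 1 - K.degree u by omega] at h2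
  exact h3.trans h2

theorem two_mul_cast_choose_two (a : ℕ) : 2 * ((a.choose 2 : ℕ) : ℤ) = a * (a - 1) := by
  rcases a with _ | a
  · simp
  · have h2 : (a + 1).choose 2 * 2 = (a + 1) * a := by
      rw [Nat.choose_two_right, Nat.add_sub_cancel]
      exact Nat.div_mul_cancel (Nat.even_mul_pred_self (a + 1)).two_dvd
    push_cast
    have : (((a + 1).choose 2 : ℕ) : ℤ) * 2 = (a + 1) * a := by exact_mod_cast h2
    linarith

theorem choose_add_mul_le_max {n k j : ℕ} (hk : 2 ≤ k) (hkn : k ≤ n - 1) (hj : 2 * j ≤ n - k) :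
    (n - k + 1 - j).choose 2 + (k - 1 + j) * j ≤
      max (Nat.choose (n - k + 1) 2)
        (Nat.choose n 2 - Nat.choose (n - (n - k) / 2) 2 +
          if Odd (n - k + 1) then 0 else 1) := by
  obtain ⟨m, rfl⟩ : ∃ m, n = m + k := ⟨n - k, by omega⟩
  obtain ⟨k, rfl⟩ : ∃ l, k = l + 1 := ⟨k - 1, by omega⟩
  obtain ⟨a, rfl⟩ : ∃ a, m = a + j := ⟨m - j, by omega⟩
  simp only [Nat.add_sub_cancel] at *
  set t := (a + j) / 2 with ht
  have hjt : j ≤ t := by omega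
  have h1 := two_mul_cast_choose_two (a + 1)
  have h2 := two_mul_cast_choose_two (a + j + 1)
  have h3 := two_mul_cast_choose_two (a + j + (k + 1))
  have h4 := two_mul_cast_choose_two (a + j + (k + 1) - t)
  have h5 : (a + j + (k + 1) - t).choose 2 ≤ (a + j + (k + 1)).choose 2 :=
    Nat.choose_le_choose 2 (by omega)
  rw [show a + j + 1 - j = a + 1 by omega]
  rw [Nat.cast_sub (by omega)] at h4
  push_cast at h1 h2 h3 h4
  rw [le_max_iff]
  by_cases hlin : (3 * j + 2 * k : ℤ) ≤ 2 * (a + j) + 1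
  · left
    zify
    have : (0 : ℤ) ≤ j * (2 * (a + j) + 1 - (3 * j + 2 * k)) :=
      mul_nonneg (by positivity) (by linarith)
    nlinarith
  · right
    push Not at hlin
    zify [h5]
    have hprod : (0 : ℤ) ≤ (t - j) * (3 * (t + j) + 2 * k - 2 * (a + j) - 1) := by
      have : (j : ℤ) ≤ t := by exact_mod_cast hjt
      exact mul_nonneg (by linarith) (by linarith)
    rcases Nat.even_or_odd (a + j) with hpar | hpar
    · rw [if_pos hpar.add_one]
      have : a + j = 2 * t := by grind
      have : (a : ℤ) = 2 * t - j := by omega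
      rw [this] at *
      nlinarith
    · rw [if_neg (by simpa using hpar.add_one)]
      have : a + j = 2 * t + 1 := by grind
      have : (a : ℤ) = 2 * t + 1 - j := by omega
      rw [this] at *
      nlinarith

/-- The complete graph on the vertices with index less than `a`, together with isolated vertices. -/
def initialClique (n a : ℕ) (h : a ≤ n) : SimpleGraph (Fin n) :=
  (⊤ : SimpleGraph (Fin a)).map (Fin.castLEEmb h)

theorem initialClique_adj {n a : ℕ} (h : a ≤ n) (x y : Fin n) :
    (initialClique n a h).Adj x y ↔ x ≠ y ∧ x.1 < a ∧ y.1 < a := by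
  rw [initialClique, map_adj]
  constructor
  · rintro ⟨u, v, huv, rfl, rfl⟩
    refine ⟨fun e => huv (by simpa using e), u.2, v.2⟩
  · rintro ⟨hne, hx, hy⟩
    refine ⟨⟨x, hx⟩, ⟨y, hy⟩, ?_, rfl, rfl⟩
    rw [top_adj]
    intro e
    exact hne (Fin.ext (by simpa using e))

theorem ncard_edgeSet_initialClique {n a : ℕ} (h : a ≤ n) :
    (initialClique n a h).edgeSet.ncard = a.choose 2 := by
  rw [initialClique, edgeSet_map, Set.ncard_image_of_injective _ (Function.Embedding.injective _),
    ← coe_edgeFinset, Set.ncard_coe_finset, card_edgeFinset_top_eq_card_choose_two, Fintype.card_fin]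

theorem ncard_edgeSet_compl_initialClique {n a : ℕ} (h : a ≤ n) :
    (initialClique n a h)ᶜ.edgeSet.ncard = n.choose 2 - a.choose 2 := by
  have h1 : (initialClique n a h)ᶜ.edgeSet =
      (⊤ : SimpleGraph (Fin n)).edgeSet \ (initialClique n a h).edgeSet := by
    rw [← edgeSet_sdiff, top_sdiff]
  rw [h1, Set.ncard_sdiff (edgeSet_mono le_top) (Set.toFinite _), ncard_edgeSet_initialClique,
    ← coe_edgeFinset, Set.ncard_coe_finset, card_edgeFinset_top_eq_card_choose_two, Fintype.card_fin]

open Fin.NatCast in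
theorem cyclicHits_initialClique_lt {N a : ℕ} (ha : 0 < a) (h : a < N + 3)
    {f : Fin (N + 3) → Fin (N + 3)} (hf : f.Injective) :
    cyclicHits (initialClique (N + 3) a h.le) f < a := by
  classical
  have hbij : f.Bijective := (Fintype.bijective_iff_injective_and_card f).2 ⟨hf, rfl⟩
  set A : Finset (Fin (N + 3)) := {i | (f i).1 < a} with hA
  have hAcard : #A = a := by
    have : #A = #({x | x.1 < a} : Finset (Fin (N + 3))) := by
      refine card_bij (fun i _ => f i) (by simp [hA]) (fun _ _ _ _ e => hf e) ?_
      intro b hb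
      obtain ⟨i, rfl⟩ := hbij.2 b
      exact ⟨i, by simpa [hA] using hb, rfl⟩
    rw [this, Fin.card_filter_val_lt]
    omega
  rw [cyclicHits_eq_card]
  refine lt_of_lt_of_eq (card_lt_card ?_) hAcard
  rw [ssubset_iff_subset_ne]
  refine ⟨fun i => by simp +contextual [hA, initialClique_adj], fun heq => ?_⟩
  have hstep : ∀ i ∈ A, i + 1 ∈ A := by
    intro i hi
    rw [← heq] at hi
    simp only [mem_filter, initialClique_adj, mem_univ, true_and] at hi
    simpa [hA] using hi.2.2
  obtain ⟨i, hi⟩ : A.Nonempty := card_pos.1 (by omega)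
  have hall : ∀ j : ℕ, i + (j : Fin (N + 3)) ∈ A := by
    intro j
    induction j with
    | zero => simpa using hi
    | succ j ih => simpa [add_assoc] using hstep _ ih
  have : A = univ := eq_univ_of_forall fun x => by
    simpa using hall (x - i : Fin (N + 3))
  rw [this, card_univ, Fintype.card_fin] at hAcard
  omega

theorem cyclicHits_compl_initialClique_le {N a : ℕ} (h : a ≤ N + 3)
    {f : Fin (N + 3) → Fin (N + 3)} (hf : f.Injective) :
    cyclicHits (initialClique (N + 3) a h)ᶜ f ≤ 2 * (N + 3 - a) := by
  classical
  have hcard : #({x | a ≤ x.1} : Finset (Fin (N + 3))) = N + 3 - a := by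
    have h1 := card_filter_add_card_filter_not (s := (univ : Finset (Fin (N + 3))))
      (fun x => x.1 < a)
    rw [Fin.card_filter_val_lt, card_univ, Fintype.card_fin] at h1
    simp only [not_lt] at h1
    omega
  have hle (g : Fin (N + 3) → Fin (N + 3)) (hg : g.Injective) : #{i | a ≤ (g i).1} ≤ N + 3 - a := by
    rw [← hcard]
    exact card_le_card_of_injOn g (by intro i; simp) hg.injOn
  rw [cyclicHits_eq_card]
  have hsub : ({i | (initialClique (N + 3) a h)ᶜ.Adj (f i) (f (i + 1))} : Finset (Fin (N + 3))) ⊆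
      ({i | a ≤ (f i).1} : Finset _) ∪ ({i | a ≤ (f (i + 1)).1} : Finset _) := by
    intro i
    simp only [compl_adj, initialClique_adj, mem_filter, mem_univ, true_and, mem_union]
    rintro ⟨hne, hn⟩
    by_contra! hcon
    exact hn ⟨hne, hcon⟩
  have h1 := (card_le_card hsub).trans (card_union_le _ _)
  have h2 := hle f hf
  have h3 := hle (fun i => f (i + 1)) (hf.comp (add_left_injective 1))
  omega

theorem cyclicHits_sup_edge_le {V : Type*} {N : ℕ} (G : SimpleGraph V) (u v : V)
    {f : Fin (N + 3) → V} (hf : f.Injective) :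
    cyclicHits (G ⊔ edge u v) f ≤ cyclicHits G f + 1 := by
  classical
  simp only [cyclicHits_eq_card, sup_adj, filter_or]
  refine (card_union_le _ _).trans (Nat.add_le_add_left ?_ _)
  rw [card_le_one]
  intro i hi j hj
  simp only [mem_filter, mem_univ, true_and, edge_adj] at hi hj
  refine cyclic_edge_injective hf ?_
  simp only [Sym2.eq_iff]
  grind

theorem stmt_16 (n k : ℕ) (hk : 2 ≤ k) (hkn : k ≤ n - 1) :
    IsGreatest
      {m : ℕ | ∃ G : SimpleGraph (Fin n), k ≤ hamCompletion G ∧ G.edgeSet.ncard = m}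
      (max (Nat.choose (n - k + 1) 2)
        (Nat.choose n 2 - Nat.choose (n - (n - k) / 2) 2 +
          if Odd (n - k + 1) then 0 else 1)) := by
  classical
  obtain ⟨N, rfl⟩ : ∃ N, n = N + 3 := ⟨n - 3, by omega⟩
  have hV : Fintype.card (Fin (N + 3)) = N + 3 := Fintype.card_fin _
  simp only [le_hamCompletion_iff hV]
  constructor
  · rcases max_choice (Nat.choose (N + 3 - k + 1) 2)
      (Nat.choose (N + 3) 2 - Nat.choose (N + 3 - (N + 3 - k) / 2) 2 +
        if Odd (N + 3 - k + 1) then 0 else 1) with hmax | hmax <;> rw [hmax]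
    · refine ⟨initialClique (N + 3) (N + 3 - k + 1) (by omega), fun f hf => ?_,
        ncard_edgeSet_initialClique _⟩
      have := cyclicHits_initialClique_lt (a := N + 3 - k + 1) (by omega) (by omega) hf
      omega
    · have hle : N + 3 - (N + 3 - k) / 2 ≤ N + 3 := Nat.sub_le _ _
      have hhits (f : Fin (N + 3) → Fin (N + 3)) (hf : f.Injective) :=
        cyclicHits_compl_initialClique_le hle hf
      split_ifs with hodd
      · refine ⟨(initialClique _ _ hle)ᶜ, fun f hf => ?_, ncard_edgeSet_compl_initialClique _⟩
        have := hhits f hf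
        omega
      · have hnadj : ¬ (initialClique _ _ hle)ᶜ.Adj (0 : Fin (N + 3)) 1 := by
          rw [compl_adj, initialClique_adj, Fin.val_zero, Fin.val_one]
          have h01 : (0 : Fin (N + 3)) ≠ 1 := by simp
          exact fun h => h.2 ⟨h01, by omega, by omega⟩
        refine ⟨(initialClique _ _ hle)ᶜ ⊔ edge 0 1, fun f hf => ?_, ?_⟩
        · have h1 := hhits f hf
          have h2 := cyclicHits_sup_edge_le (initialClique _ _ hle)ᶜ 0 1 hf
          have : (N + 3 - k) % 2 = 1 := by grind
          omega
        · rw [← ncard_edgeSet_compl_initialClique hle, ← coe_edgeFinset, Set.ncard_coe_finset,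
            card_edgeFinset_sup_edge _ hnadj (by simp), ← coe_edgeFinset, Set.ncard_coe_finset]
  · rintro _ ⟨G, hG, rfl⟩
    obtain ⟨j, hj, hle⟩ := exists_ncard_edgeSet_le (m := N + 3 - k) hV (by omega) G
      fun f hf => by have := hG f hf; omega
    rw [show N + 2 - (N + 3 - k) = k - 1 by omega] at hle
    exact hle.trans (choose_add_mul_le_max hk hkn hj)
end
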